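/- Let s₀ > 1/2 and s ≥ s₀. There is a constant C > 0 (depending on s, s₀ and the dyadic partition) such that for all smooth functions a, g : 𝕋² → ℝ, ( Σ_{k≥−1} 2^{2ks} ‖Δ^v_k(T^v_a g)‖²_{L²_v(L^{4/3}_h)} )^{1/2} ≤ C ‖a‖_{H^{1/4,s₀}} ‖g‖_{H^{0,s}}. -/

import Mathlib

open MeasureTheory Real Complex Filter Set

noncomputable section

namespace Aniso

/-- Fundamental domain `(0, 2π]` for the circle of circumference `2π`. -/
def I2pi : Set ℝ := Set.Ioc 0 (2 * π)

/-- Fundamental domain for the 2-torus `𝕋² = (ℝ/2πℤ)²`. -/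
def Q2 : Set (ℝ × ℝ) := I2pi ×ˢ I2pi

/-- Integral over the torus of a real function. -/
def tintR (f : ℝ × ℝ → ℝ) : ℝ := ∫ x in Q2, f x

/-- Smoothness of a scalar field. -/
def Smooth (f : ℝ × ℝ → ℝ) : Prop := ContDiff ℝ (⊤ : ℕ∞) f

/-- Smoothness of a vector field. -/
def SmoothV (u : ℝ × ℝ → ℝ × ℝ) : Prop := ContDiff ℝ (⊤ : ℕ∞) u

/-- `2π`-periodicity in each variable: this encodes being a function on the torus. -/
def Per (f : ℝ × ℝ → ℝ) : Prop :=
  (∀ x : ℝ × ℝ, f (x.1 + 2 * π, x.2) = f x) ∧ (∀ x : ℝ × ℝ, f (x.1, x.2 + 2 * π) = f x)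

def PerV (u : ℝ × ℝ → ℝ × ℝ) : Prop :=
  Per (fun x => (u x).1) ∧ Per (fun x => (u x).2)

/-- Partial derivative in the horizontal variable `x₁`. -/
def pd1 (f : ℝ × ℝ → ℝ) : ℝ × ℝ → ℝ := fun x => fderiv ℝ f x (1, 0)

/-- Partial derivative in the vertical variable `x₂`. -/
def pd2 (f : ℝ × ℝ → ℝ) : ℝ × ℝ → ℝ := fun x => fderiv ℝ f x (0, 1)

def comp1 (u : ℝ × ℝ → ℝ × ℝ) : ℝ × ℝ → ℝ := fun x => (u x).1
def comp2 (u : ℝ × ℝ → ℝ × ℝ) : ℝ × ℝ → ℝ := fun x => (u x).2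

def pd1V (u : ℝ × ℝ → ℝ × ℝ) : ℝ × ℝ → ℝ × ℝ := fun x => (pd1 (comp1 u) x, pd1 (comp2 u) x)
def pd2V (u : ℝ × ℝ → ℝ × ℝ) : ℝ × ℝ → ℝ × ℝ := fun x => (pd2 (comp1 u) x, pd2 (comp2 u) x)

/-- Divergence-free condition `∂₁u¹ + ∂₂u² = 0`. -/
def DivFree (u : ℝ × ℝ → ℝ × ℝ) : Prop :=
  ∀ x, pd1 (comp1 u) x + pd2 (comp2 u) x = 0

/-- The transport term `u·∇v`, with components `u¹∂₁vʲ + u²∂₂vʲ`. -/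
def advect (u v : ℝ × ℝ → ℝ × ℝ) : ℝ × ℝ → ℝ × ℝ := fun x =>
  ((u x).1 * pd1 (comp1 v) x + (u x).2 * pd2 (comp1 v) x,
   (u x).1 * pd1 (comp2 v) x + (u x).2 * pd2 (comp2 v) x)

/-- L² inner product of real vector fields on the torus (summed over components). -/
def ipV (u v : ℝ × ℝ → ℝ × ℝ) : ℝ := tintR fun x => (u x).1 * (v x).1 + (u x).2 * (v x).2

/-- The trilinear form `b(u,v,w) = ∫ (u·∇v)·w`. -/
def b3 (u v w : ℝ × ℝ → ℝ × ℝ) : ℝ := ipV (advect u v) w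

/-- L² norm of a scalar function on the torus. -/
def L2 (f : ℝ × ℝ → ℝ) : ℝ := Real.sqrt (tintR fun x => f x ^ 2)

/-- L² norm of a vector field on the torus. -/
def L2V (u : ℝ × ℝ → ℝ × ℝ) : ℝ := Real.sqrt (tintR fun x => (u x).1 ^ 2 + (u x).2 ^ 2)

/-- Fourier coefficient of a complex-valued function on the torus. -/
def fcC (f : ℝ × ℝ → ℂ) (k : ℤ × ℤ) : ℂ :=
  (1 / (2 * π) ^ 2 : ℂ) *
    ∫ x in Q2, f x * Complex.exp (-(Complex.I) * ((k.1 : ℂ) * (x.1 : ℂ) + (k.2 : ℂ) * (x.2 : ℂ)))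

/-- Fourier coefficient of a real-valued function on the torus. -/
def fc (f : ℝ × ℝ → ℝ) (k : ℤ × ℤ) : ℂ := fcC (fun x => (f x : ℂ)) k

/-- Anisotropic Sobolev weight `(1+|k₁|²)^s (1+|k₂|²)^{s'}`. -/
def aw (s s' : ℝ) (k : ℤ × ℤ) : ℝ :=
  (1 + (k.1 : ℝ) ^ 2) ^ s * (1 + (k.2 : ℝ) ^ 2) ^ s'

/-- Square of the anisotropic Sobolev norm `H^{s,s'}` of a scalar function. -/
def HSq (s s' : ℝ) (f : ℝ × ℝ → ℝ) : ℝ := ∑' k : ℤ × ℤ, aw s s' k * ‖fc f k‖ ^ 2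

/-- Anisotropic Sobolev norm `H^{s,s'}` of a scalar function. -/
def HN (s s' : ℝ) (f : ℝ × ℝ → ℝ) : ℝ := Real.sqrt (HSq s s' f)

/-- Anisotropic Sobolev norm `H^{s,s'}` of a vector field. -/
def HNV (s s' : ℝ) (u : ℝ × ℝ → ℝ × ℝ) : ℝ :=
  Real.sqrt (HSq s s' (comp1 u) + HSq s s' (comp2 u))

/-- Mixed norm `L^∞_h(L²_v)`. -/
def LinfhL2v (f : ℝ × ℝ → ℝ) : ℝ :=
  essSup (fun x1 : ℝ => Real.sqrt (∫ x2 in I2pi, f (x1, x2) ^ 2)) (volume.restrict I2pi)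

/-- Mixed norm `L²_h(L^∞_v)`. -/
def L2hLinfv (f : ℝ × ℝ → ℝ) : ℝ :=
  Real.sqrt (∫ x1 in I2pi, (essSup (fun x2 : ℝ => |f (x1, x2)|) (volume.restrict I2pi)) ^ 2)

/-- Mixed norm `L²_v(L^{4/3}_h)`. -/
def L2vL43h {E : Type*} [NormedAddCommGroup E] (f : ℝ × ℝ → E) : ℝ :=
  Real.sqrt (∫ x2 in I2pi, (∫ x1 in I2pi, ‖f (x1, x2)‖ ^ ((4 : ℝ)/3)) ^ ((3 : ℝ)/2))

/-- Mixed norm `L^∞_v(L²_h)`. -/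
def LinfvL2h {E : Type*} [NormedAddCommGroup E] (f : ℝ × ℝ → E) : ℝ :=
  essSup (fun x2 : ℝ => Real.sqrt (∫ x1 in I2pi, ‖f (x1, x2)‖ ^ 2)) (volume.restrict I2pi)

/-- Mixed norm `L²_v(L⁴_h)`. -/
def L2vL4h {E : Type*} [NormedAddCommGroup E] (f : ℝ × ℝ → E) : ℝ :=
  Real.sqrt (∫ x2 in I2pi, Real.sqrt (∫ x1 in I2pi, ‖f (x1, x2)‖ ^ 4))

/-- One-dimensional Fourier coefficient on the circle of circumference `2π`. -/
def fc1 (g : ℝ → ℂ) (n : ℤ) : ℂ :=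
  (1 / (2 * π) : ℂ) * ∫ x in I2pi, g x * Complex.exp (-(Complex.I) * ((n : ℂ) * (x : ℂ)))

/-- Square of the 1-d Sobolev norm `H^s(𝕋)`. -/
def H1Sq (s : ℝ) (g : ℝ → ℂ) : ℝ := ∑' n : ℤ, (1 + (n : ℝ) ^ 2) ^ s * ‖fc1 g n‖ ^ 2

/-- Mixed norm `L²_v(H^s_h)`. -/
def L2vHsh (s : ℝ) (f : ℝ × ℝ → ℂ) : ℝ :=
  Real.sqrt (∫ x2 in I2pi, H1Sq s (fun x1 => f (x1, x2)))

/-- A dyadic partition of unity `(χ, θ)` on `ℝ`. -/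
structure IsDyadicPartition (χ θ : ℝ → ℝ) : Prop where
  smooth_chi : ContDiff ℝ (⊤ : ℕ∞) χ
  smooth_theta : ContDiff ℝ (⊤ : ℕ∞) θ
  nonneg_chi : ∀ z, 0 ≤ χ z
  nonneg_theta : ∀ z, 0 ≤ θ z
  even_chi : ∀ z, χ (-z) = χ z
  even_theta : ∀ z, θ (-z) = θ z
  chi_support : ∃ R > 0, ∀ z, R ≤ |z| → χ z = 0
  theta_support : ∃ r R : ℝ, 0 < r ∧ r < R ∧ ∀ z, (|z| < r ∨ R < |z|) → θ z = 0
  partition : ∀ z : ℝ, χ z + ∑' j : ℕ, θ ((2 : ℝ) ^ (-(j : ℤ)) * z) = 1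
  chi_theta_disj : ∀ j : ℕ, 1 ≤ j → ∀ z, χ z * θ ((2 : ℝ) ^ (-(j : ℤ)) * z) = 0
  theta_theta_disj : ∀ i j : ℕ, 1 < |(i : ℤ) - (j : ℤ)| → ∀ z,
    θ ((2 : ℝ) ^ (-(i : ℤ)) * z) * θ ((2 : ℝ) ^ (-(j : ℤ)) * z) = 0

/-- The Fourier multiplier symbol of the vertical Littlewood–Paley block `Δ^v_j`. -/
def blockSymb (χ θ : ℝ → ℝ) (j : ℤ) (z : ℝ) : ℝ :=
  if j = -1 then χ |z| else if 0 ≤ j then θ ((2 : ℝ) ^ (-j) * |z|) else 0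

/-- The Fourier multiplier symbol of the vertical low-frequency cut-off `S^v_j`. -/
def lowSymb (χ θ : ℝ → ℝ) (j : ℤ) (z : ℝ) : ℝ :=
  ∑ j' ∈ Finset.Icc (-1 : ℤ) (j - 2), blockSymb χ θ j' z

/-- The character `e^{ik·x}`. -/
def eK (k : ℤ × ℤ) (x : ℝ × ℝ) : ℂ :=
  Complex.exp (Complex.I * ((k.1 : ℂ) * (x.1 : ℂ) + (k.2 : ℂ) * (x.2 : ℂ)))

/-- Vertical Littlewood–Paley block `Δ^v_j` of a complex-valued function. -/
def LPC (χ θ : ℝ → ℝ) (j : ℤ) (f : ℝ × ℝ → ℂ) : ℝ × ℝ → ℂ :=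
  fun x => ∑' k : ℤ × ℤ, (blockSymb χ θ j k.2 : ℂ) * fcC f k * eK k x

/-- Vertical Littlewood–Paley block `Δ^v_j` of a real-valued function. -/
def LP (χ θ : ℝ → ℝ) (j : ℤ) (f : ℝ × ℝ → ℝ) : ℝ × ℝ → ℂ :=
  LPC χ θ j fun x => (f x : ℂ)

/-- Vertical low-frequency cut-off `S^v_j` of a complex-valued function. -/
def SvC (χ θ : ℝ → ℝ) (j : ℤ) (f : ℝ × ℝ → ℂ) : ℝ × ℝ → ℂ :=
  fun x => ∑' k : ℤ × ℤ, (lowSymb χ θ j k.2 : ℂ) * fcC f k * eK k x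

/-- Vertical low-frequency cut-off `S^v_j` of a real-valued function. -/
def Sv (χ θ : ℝ → ℝ) (j : ℤ) (f : ℝ × ℝ → ℝ) : ℝ × ℝ → ℂ :=
  SvC χ θ j fun x => (f x : ℂ)

/-- Componentwise Littlewood–Paley block of a vector field. -/
def LPV (χ θ : ℝ → ℝ) (j : ℤ) (u : ℝ × ℝ → ℝ × ℝ) : ℝ × ℝ → ℂ × ℂ :=
  fun x => (LP χ θ j (comp1 u) x, LP χ θ j (comp2 u) x)

/-- Componentwise low-frequency cut-off of a vector field. -/
def SvV (χ θ : ℝ → ℝ) (j : ℤ) (u : ℝ × ℝ → ℝ × ℝ) : ℝ × ℝ → ℂ × ℂ :=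
  fun x => (Sv χ θ j (comp1 u) x, Sv χ θ j (comp2 u) x)

/-- L² inner product of complex-valued functions on the torus. -/
def ipC (f g : ℝ × ℝ → ℂ) : ℂ := ∫ x in Q2, f x * (starRingEnd ℂ) (g x)

/-- L² inner product of complex vector fields on the torus (summed over components). -/
def ipCV (f g : ℝ × ℝ → ℂ × ℂ) : ℂ :=
  ∫ x in Q2, ((f x).1 * (starRingEnd ℂ) ((g x).1) + (f x).2 * (starRingEnd ℂ) ((g x).2))

/-- The vertical paraproduct `T^v_a g = Σ_j S^v_{j-1}a · Δ^v_j g`. -/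
def Tv (χ θ : ℝ → ℝ) (a g : ℝ × ℝ → ℝ) : ℝ × ℝ → ℂ :=
  fun x => ∑' j : ℤ, Sv χ θ (j - 1) a x * LP χ θ j g x

/-- The vertical remainder `R^v(a,g) = Σ_{|j-j'|≤1} Δ^v_j a · Δ^v_{j'} g`. -/
def Rv (χ θ : ℝ → ℝ) (a g : ℝ × ℝ → ℝ) : ℝ × ℝ → ℂ :=
  fun x => ∑' p : ℤ × ℤ, if |p.1 - p.2| ≤ 1 then LP χ θ p.1 a x * LP χ θ p.2 g x else 0

/-- The one-dimensional character `e^{inx}`. -/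
def chr (n : ℤ) (x : ℝ) : ℂ := Complex.exp (Complex.I * ((n : ℂ) * (x : ℂ)))

theorem continuous_chr (n : ℤ) : Continuous (chr n) := by
  unfold chr; fun_prop

theorem norm_chr (n : ℤ) (x : ℝ) : ‖chr n x‖ = 1 := by
  rw [chr, mul_comm]
  exact_mod_cast Complex.norm_exp_ofReal_mul_I ((n : ℝ) * x)

theorem chr_add (m n : ℤ) (x : ℝ) : chr (m + n) x = chr m x * chr n x := by
  rw [chr, chr, chr, ← Complex.exp_add]; push_cast; ring_nf

theorem conj_chr (n : ℤ) (x : ℝ) : (starRingEnd ℂ) (chr n x) = chr (-n) x := by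
  rw [chr, chr, ← Complex.exp_conj]; simp

theorem eK_eq (k : ℤ × ℤ) (x : ℝ × ℝ) : eK k x = chr k.1 x.1 * chr k.2 x.2 := by
  rw [eK, chr, chr, ← Complex.exp_add]; ring_nf

theorem norm_eK (k : ℤ × ℤ) (x : ℝ × ℝ) : ‖eK k x‖ = 1 := by
  rw [eK_eq, norm_mul, norm_chr, norm_chr, one_mul]

theorem continuous_eK (k : ℤ × ℤ) : Continuous (eK k) := by
  unfold eK; fun_prop

theorem eK_add (k l : ℤ × ℤ) (x : ℝ × ℝ) : eK (k + l) x = eK k x * eK l x := by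
  simp only [eK_eq, Prod.fst_add, Prod.snd_add, chr_add]; ring

theorem exp_neg_eq_eK (k : ℤ × ℤ) (x : ℝ × ℝ) :
    Complex.exp (-(Complex.I) * ((k.1 : ℂ) * (x.1 : ℂ) + (k.2 : ℂ) * (x.2 : ℂ))) = eK (-k) x := by
  rw [eK]; congr 1; simp; ring

theorem integral_chr (n : ℤ) : ∫ x in I2pi, chr n x = if n = 0 then 2 * (π : ℂ) else 0 := by
  rw [I2pi, ← intervalIntegral.integral_of_le (by positivity)]
  split_ifs with h
  · subst h; simp [chr]
  · have h' : Complex.I * (n : ℂ) ≠ 0 := mul_ne_zero Complex.I_ne_zero (by exact_mod_cast h)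
    have := integral_exp_mul_complex (a := 0) (b := 2 * π) h'
    simp only [chr, ← mul_assoc]
    rw [this]
    have h1 : Complex.exp (Complex.I * n * ((2 * π : ℝ) : ℂ)) = 1 := by
      rw [← Complex.exp_int_mul_two_pi_mul_I n]; congr 1; push_cast; ring
    rw [h1]; simp

instance : IsFiniteMeasure (volume.restrict I2pi) := by
  unfold I2pi; infer_instance

theorem integrableOn_I2pi {E : Type*} [NormedAddCommGroup E] {f : ℝ → E} (hf : Continuous f) :
    IntegrableOn f I2pi :=
  (hf.integrableOn_Icc (a := 0) (b := 2 * π)).mono_set Ioc_subset_Icc_self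

theorem integrableOn_Q2 {E : Type*} [NormedAddCommGroup E] {f : ℝ × ℝ → E} (hf : Continuous f) :
    IntegrableOn f Q2 :=
  (hf.continuousOn.integrableOn_compact
    (isCompact_Icc (a := (0 : ℝ)) (b := 2 * π) |>.prod (isCompact_Icc (a := (0 : ℝ)) (b := 2 * π)))).mono_set
    (prod_mono Ioc_subset_Icc_self Ioc_subset_Icc_self)

/-- Exchanging an absolutely convergent series of unimodular functions with an integral. -/
theorem integral_tsum_unimodular_mul {X ι : Type*} [MeasurableSpace X] [Countable ι]
    {μ : Measure X} {e : ι → X → ℂ}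
    (he : ∀ i x, ‖e i x‖ = 1) (hem : ∀ i, AEStronglyMeasurable (e i) μ) {c : ι → ℂ}
    (hc : Summable fun i => ‖c i‖) {φ : X → ℂ} (hφ : Integrable φ μ) :
    ∫ x, (∑' i, c i * e i x) * φ x ∂μ = ∑' i, c i * ∫ x, e i x * φ x ∂μ := by
  have hint : ∀ i, Integrable (fun x => c i * (e i x * φ x)) μ := fun i =>
    (hφ.bdd_mul (hem i) (ae_of_all _ fun x => (he i x).le)).const_mul _
  have := integral_tsum_of_summable_integral_norm hint (by
    simp only [norm_mul, he, one_mul, integral_const_mul]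
    exact hc.mul_right _)
  simp only [integral_const_mul] at this
  rw [this]
  congr 1; ext x
  rw [← tsum_mul_right]
  simp only [mul_assoc]

theorem summable_mul_unimodular {ι : Type*} {c e : ι → ℂ} (he : ∀ i, ‖e i‖ = 1)
    (hc : Summable fun i => ‖c i‖) : Summable fun i => c i * e i :=
  Summable.of_norm (by simpa [norm_mul, he] using hc)

theorem continuous_tsum_chr {c : ℤ → ℂ} (hc : Summable fun n => ‖c n‖) :
    Continuous fun x => ∑' n, c n * chr n x :=
  continuous_tsum (fun n => continuous_const.mul (continuous_chr n)) hc
    fun n x => by simp [norm_chr]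

theorem continuous_tsum_eK {c : ℤ × ℤ → ℂ} (hc : Summable fun n => ‖c n‖) :
    Continuous fun x => ∑' n, c n * eK n x :=
  continuous_tsum (fun n => continuous_const.mul (continuous_eK n)) hc
    fun n x => by simp [norm_eK]

theorem integral_tsum_chr_mul_chr_neg {c : ℤ → ℂ} (hc : Summable fun n => ‖c n‖) (m : ℤ) :
    ∫ x in I2pi, (∑' n, c n * chr n x) * chr (-m) x = 2 * π * c m := by
  rw [integral_tsum_unimodular_mul norm_chr
    (fun i => (continuous_chr i).aestronglyMeasurable) hc (integrableOn_I2pi (continuous_chr _))]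
  simp only [← chr_add, integral_chr]
  rw [tsum_eq_single m]
  · simp [mul_comm]
  · intro n hn
    simp [← sub_eq_add_neg, sub_eq_zero, hn]

/-- Uniqueness of Fourier coefficients for absolutely convergent Fourier series. -/
theorem fcC_tsum_eK {c : ℤ × ℤ → ℂ} (hc : Summable fun n => ‖c n‖) (m : ℤ × ℤ) :
    fcC (fun x => ∑' n, c n * eK n x) m = c m := by
  have horth : ∀ k : ℤ × ℤ, ∫ x in Q2, eK k x = if k = 0 then (2 * (π : ℂ)) ^ 2 else 0 := by
    intro k
    simp only [eK_eq]
    have := setIntegral_prod_mul (μ := volume) (ν := volume) (chr k.1) (chr k.2) I2pi I2pi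
    rw [Q2, Measure.volume_eq_prod, this, integral_chr, integral_chr]
    rcases k with ⟨k1, k2⟩
    by_cases h1 : k1 = 0 <;> by_cases h2 : k2 = 0 <;> simp [h1, h2, pow_two]
  rw [fcC]
  simp only [exp_neg_eq_eK]
  rw [integral_tsum_unimodular_mul norm_eK
    (fun i => (continuous_eK i).aestronglyMeasurable) hc (integrableOn_Q2 (continuous_eK _))]
  simp only [← eK_add, horth]
  rw [tsum_eq_single m]
  · have : (π : ℂ) ≠ 0 := by exact_mod_cast Real.pi_ne_zero
    simp; field_simp
  · intro n hn
    simp [← sub_eq_add_neg, sub_eq_zero, hn]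

theorem integral_norm_sq_tsum_chr {c : ℤ → ℂ} (hc : Summable fun n => ‖c n‖) :
    ∫ x in I2pi, ‖∑' n, c n * chr n x‖ ^ 2 = 2 * π * ∑' n, ‖c n‖ ^ 2 := by
  have hcont : Continuous fun x => (starRingEnd ℂ) (∑' n, c n * chr n x) :=
    Complex.continuous_conj.comp (continuous_tsum_chr hc)
  have h : ∫ x in I2pi, (∑' n, c n * chr n x) * (starRingEnd ℂ) (∑' n, c n * chr n x)
      = ∑' n, c n * (2 * π * (starRingEnd ℂ) (c n)) := by
    rw [integral_tsum_unimodular_mul norm_chr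
      (fun i => (continuous_chr i).aestronglyMeasurable) hc
      (integrableOn_I2pi hcont)]
    refine tsum_congr fun n => ?_
    congr 1
    have h2 := congrArg (starRingEnd ℂ) (integral_tsum_chr_mul_chr_neg hc n)
    rw [← integral_conj] at h2
    simp only [map_mul, conj_chr, neg_neg, Complex.conj_ofReal] at h2
    rw [show (starRingEnd ℂ) 2 = 2 from Complex.conj_ofNat 2] at h2
    rw [← h2]
    congr 1; ext x; ring
  apply Complex.ofReal_injective
  rw [← integral_complex_ofReal]
  simp only [Complex.mul_conj'] at h
  push_cast
  rw [h, ← tsum_mul_left]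
  refine tsum_congr fun n => ?_
  rw [← Complex.mul_conj']; ring

theorem summable_sq_of_summable {ι : Type*} {c : ι → ℂ} (hc : Summable fun n => ‖c n‖) :
    Summable fun n => ‖c n‖ ^ 2 := by
  refine Summable.of_norm_bounded_eventually hc ?_
  filter_upwards [hc.tendsto_cofinite_zero.eventually (gt_mem_nhds one_pos)] with n hn
  rw [norm_pow, norm_norm]
  exact pow_le_of_le_one (norm_nonneg _) hn.le two_ne_zero

/-- Parseval's identity for absolutely convergent Fourier series. -/
theorem lintegral_enorm_sq_tsum_chr {c : ℤ → ℂ} (hc : Summable fun n => ‖c n‖) :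
    ∫⁻ x in I2pi, ‖∑' n, c n * chr n x‖ₑ ^ 2 = ENNReal.ofReal (2 * π) * ∑' n, ‖c n‖ₑ ^ 2 := by
  have hcont : Continuous fun x => ‖∑' n, c n * chr n x‖ ^ 2 :=
    (continuous_tsum_chr hc).norm.pow 2
  have h1 : ∀ z : ℂ, ‖z‖ₑ ^ 2 = ENNReal.ofReal (‖z‖ ^ 2) := fun z => by
    rw [ENNReal.ofReal_pow (norm_nonneg _), ofReal_norm]
  simp only [h1]
  rw [← ofReal_integral_eq_lintegral_ofReal (integrableOn_I2pi hcont)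
    (ae_of_all _ fun x => by positivity), integral_norm_sq_tsum_chr hc,
    ENNReal.ofReal_mul (by positivity),
    ENNReal.ofReal_tsum_of_nonneg (fun n => by positivity) (summable_sq_of_summable hc)]

theorem hasDerivAt_chr (n : ℤ) (x : ℝ) : HasDerivAt (chr n) (Complex.I * n * chr n x) x := by
  have h1 : HasDerivAt (fun x : ℝ => Complex.I * ((n : ℂ) * (x : ℂ))) (Complex.I * (n * 1)) x :=
    ((Complex.ofRealCLM.hasDerivAt (x := x)).const_mul (n : ℂ)).const_mul Complex.I
  have h2 := h1.cexp
  rw [show Complex.I * n * chr n x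
    = Complex.exp (Complex.I * ((n : ℂ) * (x : ℂ))) * (Complex.I * (n * 1)) by rw [chr]; ring]
  exact h2

/-- Integration by parts against a character over one period. -/
theorem integral_deriv_mul_chr {u u' : ℝ → ℝ} (hu : ∀ x, HasDerivAt u (u' x) x)
    (hu' : Continuous u') (hper : u (2 * π) = u 0) (n : ℤ) :
    ∫ x in I2pi, (u' x : ℂ) * chr (-n) x = Complex.I * n * ∫ x in I2pi, (u x : ℂ) * chr (-n) x := by
  have h2π : (0 : ℝ) ≤ 2 * π := by positivity
  have hcu : Continuous u := continuous_iff_continuousAt.2 fun x => (hu x).continuousAt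
  simp only [I2pi, ← intervalIntegral.integral_of_le h2π]
  have hd : ∀ x, HasDerivAt (fun x => (u x : ℂ)) (u' x : ℂ) x := fun x => (hu x).ofReal_comp
  have hc : Continuous fun x => (u' x : ℂ) := Complex.continuous_ofReal.comp hu'
  have hv : Continuous fun x => Complex.I * ((-n : ℤ) : ℂ) * chr (-n) x :=
    continuous_const.mul (continuous_chr _)
  have h := intervalIntegral.integral_mul_deriv_eq_deriv_mul (a := 0) (b := 2 * π)
    (fun x _ => hasDerivAt_chr (-n) x) (fun x _ => hd x) (hv.intervalIntegrable _ _)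
    (hc.intervalIntegrable _ _)
  have hbd : chr (-n) (2 * π) = chr (-n) 0 := by
    have := Complex.exp_int_mul_two_pi_mul_I (-n)
    rw [chr, chr, show Complex.I * (((-n : ℤ) : ℂ) * ((2 * π : ℝ) : ℂ))
      = ((-n : ℤ) : ℂ) * (2 * π * Complex.I) by push_cast; ring, this]
    simp
  rw [hper, hbd, sub_self, zero_sub] at h
  simp only [mul_comm _ (chr (-n) _)]
  rw [h, ← intervalIntegral.integral_neg, ← intervalIntegral.integral_const_mul]
  congr 1; ext x; push_cast; ring

theorem contDiff_fderiv_apply {f : ℝ × ℝ → ℝ} (hf : Smooth f) (v : ℝ × ℝ) :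
    Smooth fun x => fderiv ℝ f x v := by
  have : ContDiff ℝ (⊤ : ℕ∞) (fderiv ℝ f) := ContDiff.fderiv_right hf (by simp)
  exact this.clm_apply contDiff_const

theorem Per.fderiv_apply {f : ℝ × ℝ → ℝ} (hp : Per f) (v : ℝ × ℝ) :
    Per fun x => fderiv ℝ f x v := by
  constructor
  · intro x
    have hshift : (fun y => f (y + (2 * π, 0))) = f := by
      ext y; rw [← hp.1 y]; congr 1; ext <;> simp
    have h := fderiv_comp_add_right (𝕜 := ℝ) (f := f) (x := x) (2 * π, 0)
    rw [hshift] at h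
    change fderiv ℝ f _ v = fderiv ℝ f x v
    rw [h]
    congr 2; ext <;> simp
  · intro x
    have hshift : (fun y => f (y + (0, 2 * π))) = f := by
      ext y; rw [← hp.2 y]; congr 1; ext <;> simp
    have h := fderiv_comp_add_right (𝕜 := ℝ) (f := f) (x := x) (0, 2 * π)
    rw [hshift] at h
    change fderiv ℝ f _ v = fderiv ℝ f x v
    rw [h]
    congr 2; ext <;> simp

theorem Smooth.hasDerivAt_fst {f : ℝ × ℝ → ℝ} (hf : Smooth f) (x y : ℝ) :
    HasDerivAt (fun t => f (t, y)) (pd1 f (x, y)) x := by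
  have h1 : HasFDerivAt f (fderiv ℝ f (x, y)) (x, y) :=
    ((ContDiff.differentiable hf (by simp)) (x, y)).hasFDerivAt
  exact h1.comp_hasDerivAt x ((hasDerivAt_id x).prodMk (hasDerivAt_const x y))

theorem Smooth.hasDerivAt_snd {f : ℝ × ℝ → ℝ} (hf : Smooth f) (x y : ℝ) :
    HasDerivAt (fun t => f (x, t)) (pd2 f (x, y)) y := by
  have h1 : HasFDerivAt f (fderiv ℝ f (x, y)) (x, y) :=
    ((ContDiff.differentiable hf (by simp)) (x, y)).hasFDerivAt
  exact h1.comp_hasDerivAt y ((hasDerivAt_const y x).prodMk (hasDerivAt_id y))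

theorem Smooth.continuous {f : ℝ × ℝ → ℝ} (hf : Smooth f) : Continuous f :=
  ContDiff.continuous hf

theorem fc_eq_integral_fst {f : ℝ × ℝ → ℝ} (hf : Continuous f) (k : ℤ × ℤ) :
    fc f k = (1 / (2 * π) ^ 2 : ℂ) *
      ∫ y in I2pi, (∫ x in I2pi, (f (x, y) : ℂ) * chr (-k.1) x) * chr (-k.2) y := by
  have hcont : Continuous fun x : ℝ × ℝ => (f x : ℂ) * eK (-k) x :=
    (Complex.continuous_ofReal.comp hf).mul (continuous_eK _)
  have hint := integrableOn_Q2 hcont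
  rw [IntegrableOn, Q2, Measure.volume_eq_prod, ← Measure.prod_restrict] at hint
  rw [fc, fcC]
  simp only [exp_neg_eq_eK]
  rw [Q2, Measure.volume_eq_prod, ← Measure.prod_restrict, integral_prod_symm _ hint]
  congr 2; ext y
  rw [← integral_mul_const]
  congr 1; ext x
  rw [eK_eq]; simp [mul_assoc]

theorem fc_eq_integral_snd {f : ℝ × ℝ → ℝ} (hf : Continuous f) (k : ℤ × ℤ) :
    fc f k = (1 / (2 * π) ^ 2 : ℂ) *
      ∫ x in I2pi, (∫ y in I2pi, (f (x, y) : ℂ) * chr (-k.2) y) * chr (-k.1) x := by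
  have hcont : Continuous fun x : ℝ × ℝ => (f x : ℂ) * eK (-k) x :=
    (Complex.continuous_ofReal.comp hf).mul (continuous_eK _)
  have hint := integrableOn_Q2 hcont
  rw [IntegrableOn, Q2, Measure.volume_eq_prod, ← Measure.prod_restrict] at hint
  rw [fc, fcC]
  simp only [exp_neg_eq_eK]
  rw [Q2, Measure.volume_eq_prod, ← Measure.prod_restrict, integral_prod _ hint]
  congr 2; ext x
  rw [← integral_mul_const]
  congr 1; ext y
  rw [eK_eq]; simp only [Prod.fst_neg, Prod.snd_neg]; ring

theorem fc_pd1 {f : ℝ × ℝ → ℝ} (hf : Smooth f) (hp : Per f) (k : ℤ × ℤ) :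
    fc (pd1 f) k = Complex.I * k.1 * fc f k := by
  have hc : Continuous (pd1 f) := (contDiff_fderiv_apply hf (1, 0)).continuous
  rw [fc_eq_integral_fst hc, fc_eq_integral_fst hf.continuous]
  have : ∀ y, ∫ x in I2pi, (pd1 f (x, y) : ℂ) * chr (-k.1) x
      = Complex.I * k.1 * ∫ x in I2pi, (f (x, y) : ℂ) * chr (-k.1) x := fun y =>
    integral_deriv_mul_chr (fun x => hf.hasDerivAt_fst x y) (by fun_prop)
      (by simpa using hp.1 (0, y)) k.1
  simp only [this, mul_assoc, integral_const_mul]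
  ring

theorem fc_pd2 {f : ℝ × ℝ → ℝ} (hf : Smooth f) (hp : Per f) (k : ℤ × ℤ) :
    fc (pd2 f) k = Complex.I * k.2 * fc f k := by
  have hc : Continuous (pd2 f) := (contDiff_fderiv_apply hf (0, 1)).continuous
  rw [fc_eq_integral_snd hc, fc_eq_integral_snd hf.continuous]
  have : ∀ x, ∫ y in I2pi, (pd2 f (x, y) : ℂ) * chr (-k.2) y
      = Complex.I * k.2 * ∫ y in I2pi, (f (x, y) : ℂ) * chr (-k.2) y := fun x =>
    integral_deriv_mul_chr (fun y => hf.hasDerivAt_snd x y) (by fun_prop)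
      (by simpa using hp.2 (x, 0)) k.2
  simp only [this, mul_assoc, integral_const_mul]
  ring

theorem fc_sub {f g : ℝ × ℝ → ℝ} (hf : Continuous f) (hg : Continuous g) (k : ℤ × ℤ) :
    fc (fun x => f x - g x) k = fc f k - fc g k := by
  simp only [fc, fcC, exp_neg_eq_eK]
  rw [← mul_sub, ← integral_sub]
  · congr 2; ext x; push_cast; ring
  · exact integrableOn_Q2 ((Complex.continuous_ofReal.comp hf).mul (continuous_eK _))
  · exact integrableOn_Q2 ((Complex.continuous_ofReal.comp hg).mul (continuous_eK _))

theorem Per.sub {f g : ℝ × ℝ → ℝ} (hf : Per f) (hg : Per g) : Per fun x => f x - g x :=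
  ⟨fun x => congrArg₂ _ (hf.1 x) (hg.1 x), fun x => congrArg₂ _ (hf.2 x) (hg.2 x)⟩

theorem exists_norm_fc_le (f : ℝ × ℝ → ℝ) : ∃ C, ∀ k, ‖fc f k‖ ≤ C := by
  refine ⟨‖(1 / (2 * π) ^ 2 : ℂ)‖ * ∫ x in Q2, |f x|, fun k => ?_⟩
  rw [fc, fcC, norm_mul]
  gcongr
  refine (norm_integral_le_integral_norm _).trans_eq ?_
  simp only [exp_neg_eq_eK, norm_mul, norm_eK, mul_one, Complex.norm_real, Real.norm_eq_abs]

/-- Rapid decay of the Fourier coefficients of a smooth periodic function. -/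
theorem exists_decay_fc (M N : ℕ) : ∀ {f : ℝ × ℝ → ℝ}, Smooth f → Per f →
    ∃ C, ∀ k : ℤ × ℤ, (1 + (k.1 : ℝ) ^ 2) ^ M * (1 + (k.2 : ℝ) ^ 2) ^ N * ‖fc f k‖ ≤ C := by
  have hcast : ∀ n : ℤ, ‖(1 + (n : ℂ) ^ 2 : ℂ)‖ = 1 + (n : ℝ) ^ 2 := fun n => by
    rw [show (1 + (n : ℂ) ^ 2 : ℂ) = ((1 + (n : ℝ) ^ 2 : ℝ) : ℂ) by push_cast; ring,
      Complex.norm_of_nonneg (by positivity)]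
  induction M with
  | zero =>
    induction N with
    | zero => intro f hf _; simpa using exists_norm_fc_le f
    | succ N ih =>
      intro f hf hp
      have h1 : Smooth (pd2 f) := contDiff_fderiv_apply hf _
      have h2 : Smooth (pd2 (pd2 f)) := contDiff_fderiv_apply h1 _
      have p1 : Per (pd2 f) := hp.fderiv_apply _
      have p2 : Per (pd2 (pd2 f)) := p1.fderiv_apply _
      obtain ⟨C, hC⟩ := ih (f := fun x => f x - pd2 (pd2 f) x) (ContDiff.sub hf h2) (hp.sub p2)
      refine ⟨C, fun k => ?_⟩
      have : fc (fun x => f x - pd2 (pd2 f) x) k = (1 + (k.2 : ℂ) ^ 2) * fc f k := by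
        rw [fc_sub hf.continuous h2.continuous, fc_pd2 h1 p1, fc_pd2 hf hp]
        linear_combination -(k.2 : ℂ) ^ 2 * fc f k * Complex.I_sq
      have h := hC k
      rw [this, norm_mul, hcast] at h
      refine le_of_eq_of_le ?_ h
      ring
  | succ M ih =>
    intro f hf hp
    have h1 : Smooth (pd1 f) := contDiff_fderiv_apply hf _
    have h2 : Smooth (pd1 (pd1 f)) := contDiff_fderiv_apply h1 _
    have p1 : Per (pd1 f) := hp.fderiv_apply _
    have p2 : Per (pd1 (pd1 f)) := p1.fderiv_apply _
    obtain ⟨C, hC⟩ := ih (f := fun x => f x - pd1 (pd1 f) x) (ContDiff.sub hf h2) (hp.sub p2)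
    refine ⟨C, fun k => ?_⟩
    have : fc (fun x => f x - pd1 (pd1 f) x) k = (1 + (k.1 : ℂ) ^ 2) * fc f k := by
      rw [fc_sub hf.continuous h2.continuous, fc_pd1 h1 p1, fc_pd1 hf hp]
      linear_combination -(k.1 : ℂ) ^ 2 * fc f k * Complex.I_sq
    have h := hC k
    rw [this, norm_mul, hcast] at h
    refine le_of_eq_of_le ?_ h
    ring

theorem summable_rpow_neg_one_add_sq {p : ℝ} (hp : 1 / 2 < p) :
    Summable fun n : ℤ => (1 + (n : ℝ) ^ 2) ^ (-p) := by
  have h : Summable fun n : ℤ => |(n : ℝ)| ^ (-(2 * p)) :=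
    Real.summable_abs_int_rpow (by linarith)
  refine Summable.of_norm_bounded_eventually h ?_
  filter_upwards [(Set.finite_singleton (0 : ℤ)).compl_mem_cofinite] with n hn
  have hn' : (n : ℝ) ≠ 0 := by exact_mod_cast hn
  rw [Real.norm_of_nonneg (by positivity), ← mul_neg, Real.rpow_mul (abs_nonneg _)]
  refine Real.rpow_le_rpow_of_nonpos (by positivity) ?_ (by linarith)
  rw [Real.rpow_two, sq_abs]; linarith

theorem aw_nonneg (p q : ℝ) (k : ℤ × ℤ) : 0 ≤ aw p q k := by unfold aw; positivity

theorem summable_aw_mul_norm_fc {f : ℝ × ℝ → ℝ} (hf : Smooth f) (hp : Per f) (p q : ℝ) :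
    Summable fun k => aw p q k * ‖fc f k‖ := by
  obtain ⟨M, hM⟩ := exists_nat_ge (p + 1)
  obtain ⟨N, hN⟩ := exists_nat_ge (q + 1)
  obtain ⟨C, hC⟩ := exists_decay_fc M N hf hp
  have h1 := summable_rpow_neg_one_add_sq (p := 1) (by norm_num)
  have h2 : Summable fun k : ℤ × ℤ =>
      (1 + (k.1 : ℝ) ^ 2) ^ (-1 : ℝ) * (1 + (k.2 : ℝ) ^ 2) ^ (-1 : ℝ) :=
    h1.mul_of_nonneg h1 (fun n => by positivity) fun n => by positivity
  refine Summable.of_nonneg_of_le (fun k => mul_nonneg (aw_nonneg _ _ _) (norm_nonneg _)) ?_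
    (h2.mul_left C)
  intro k
  have key : ∀ (n : ℤ) (r : ℝ) (K : ℕ), r + 1 ≤ K →
      (1 + (n : ℝ) ^ 2) ^ r ≤ (1 + (n : ℝ) ^ 2) ^ K * (1 + (n : ℝ) ^ 2) ^ (-1 : ℝ) := by
    intro n r K hK
    rw [← Real.rpow_natCast _ K, ← Real.rpow_add (by positivity)]
    exact Real.rpow_le_rpow_of_exponent_le (by nlinarith [sq_nonneg (n : ℝ)]) (by linarith)
  calc aw p q k * ‖fc f k‖
      ≤ ((1 + (k.1 : ℝ) ^ 2) ^ M * (1 + (k.1 : ℝ) ^ 2) ^ (-1 : ℝ)) *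
        ((1 + (k.2 : ℝ) ^ 2) ^ N * (1 + (k.2 : ℝ) ^ 2) ^ (-1 : ℝ)) * ‖fc f k‖ := by
        unfold aw
        gcongr
        · exact key _ _ _ hM
        · exact key _ _ _ hN
    _ = ((1 + (k.1 : ℝ) ^ 2) ^ M * (1 + (k.2 : ℝ) ^ 2) ^ N * ‖fc f k‖) *
        ((1 + (k.1 : ℝ) ^ 2) ^ (-1 : ℝ) * (1 + (k.2 : ℝ) ^ 2) ^ (-1 : ℝ)) := by ring
    _ ≤ _ := by gcongr; exact hC k

theorem summable_norm_fc {f : ℝ × ℝ → ℝ} (hf : Smooth f) (hp : Per f) :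
    Summable fun k => ‖fc f k‖ := by
  simpa [aw] using summable_aw_mul_norm_fc hf hp 0 0

theorem summable_aw_mul_norm_fc_sq {f : ℝ × ℝ → ℝ} (hf : Smooth f) (hp : Per f) (p q : ℝ) :
    Summable fun k => aw p q k * ‖fc f k‖ ^ 2 := by
  obtain ⟨C, hC⟩ := exists_norm_fc_le f
  refine Summable.of_nonneg_of_le (fun k => mul_nonneg (aw_nonneg _ _ _) (by positivity)) ?_
    ((summable_aw_mul_norm_fc hf hp p q).mul_left C)
  intro k
  have := mul_le_mul_of_nonneg_left (hC k) (mul_nonneg (aw_nonneg p q k) (norm_nonneg (fc f k)))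
  calc _ = aw p q k * ‖fc f k‖ * ‖fc f k‖ := by ring
    _ ≤ _ := by linarith

/-- The Sobolev weight `(1+n²)^p` as an extended nonnegative real. -/
def wt (p : ℝ) (n : ℤ) : ENNReal := ENNReal.ofReal ((1 + (n : ℝ) ^ 2) ^ p)

theorem wt_mul_wt (p q : ℝ) (n : ℤ) : wt p n * wt q n = wt (p + q) n := by
  rw [wt, wt, wt, ← ENNReal.ofReal_mul (by positivity), Real.rpow_add (by positivity)]

theorem wt_zero (n : ℤ) : wt 0 n = 1 := by simp [wt]

theorem wt_pow_two (p : ℝ) (n : ℤ) : wt p n ^ 2 = wt (2 * p) n := by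
  rw [pow_two, wt_mul_wt, two_mul]

theorem ennreal_two_mul_mul_le (x y : ENNReal) : 2 * (x * y) ≤ x ^ 2 + y ^ 2 := by
  rcases eq_or_ne x ⊤ with rfl | hx
  · simp
  rcases eq_or_ne y ⊤ with rfl | hy
  · simp
  lift x to NNReal using hx
  lift y to NNReal using hy
  norm_cast
  rw [← mul_assoc]
  exact two_mul_le_add_sq x y

theorem tsum_mul_sq_le {ι : Type*} (f g : ι → ENNReal) :
    (∑' i, f i * g i) ^ 2 ≤ (∑' i, f i ^ 2) * ∑' i, g i ^ 2 := by
  have h2 : (2 : ENNReal) ≠ 0 := two_ne_zero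
  have key : 2 * (∑' i, f i * g i) ^ 2 ≤ 2 * ((∑' i, f i ^ 2) * ∑' i, g i ^ 2) := by
    calc 2 * (∑' i, f i * g i) ^ 2
        = ∑' i, ∑' j, 2 * ((f i * g j) * (f j * g i)) := by
          rw [pow_two, ← ENNReal.tsum_mul_right, ← ENNReal.tsum_mul_left]
          refine tsum_congr fun i => ?_
          rw [← ENNReal.tsum_mul_left, ← ENNReal.tsum_mul_left]
          refine tsum_congr fun j => by ring
      _ ≤ ∑' i, ∑' j, ((f i * g j) ^ 2 + (f j * g i) ^ 2) :=
          ENNReal.tsum_le_tsum fun i => ENNReal.tsum_le_tsum fun j => ennreal_two_mul_mul_le _ _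
      _ = _ := by
          simp only [ENNReal.tsum_add, mul_pow, ENNReal.tsum_mul_left, ENNReal.tsum_mul_right]
          ring
  exact (ENNReal.mul_le_mul_iff_right h2 (by simp)).1 key

/-- Young's convolution inequality `ℓ¹ * ℓ² ⊂ ℓ²`. -/
theorem tsum_conv_sq_le {G : Type*} [AddCommGroup G] (a g : G → ENNReal) :
    ∑' n, (∑' m, a m * g (n - m)) ^ 2 ≤ (∑' m, a m) ^ 2 * ∑' l, g l ^ 2 := by
  have hsq : ∀ x : ENNReal, (x ^ (1 / 2 : ℝ)) ^ 2 = x := fun x => by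
    rw [← ENNReal.rpow_two, ← ENNReal.rpow_mul]; norm_num
  have h1 : ∀ n, (∑' m, a m * g (n - m)) ^ 2 ≤ (∑' m, a m) * ∑' m, a m * g (n - m) ^ 2 := by
    intro n
    have := tsum_mul_sq_le (fun m => a m ^ (1 / 2 : ℝ)) fun m => a m ^ (1 / 2 : ℝ) * g (n - m)
    simpa only [← mul_assoc, ← pow_two, mul_pow, hsq] using this
  calc _ ≤ ∑' n, (∑' m, a m) * ∑' m, a m * g (n - m) ^ 2 := ENNReal.tsum_le_tsum h1
    _ = (∑' m, a m) * ∑' m, a m * ∑' n, g (n - m) ^ 2 := by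
        rw [ENNReal.tsum_mul_left, ENNReal.tsum_comm]
        simp only [ENNReal.tsum_mul_left]
    _ = (∑' m, a m) * ∑' m, a m * ∑' n, g n ^ 2 := by
        congr 2; ext m; congr 1
        exact (Equiv.subRight m).tsum_eq fun n => g n ^ 2
    _ = _ := by rw [ENNReal.tsum_mul_right, pow_two, mul_assoc]

theorem sum_range_one_add_sq_rpow_le (N : ℕ) :
    ∑ m ∈ Finset.range (N + 1), (1 + ((m : ℤ) : ℝ) ^ 2) ^ (-(1 / 4) : ℝ) ≤ 1 + 2 * Real.sqrt N := by
  induction N with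
  | zero => simp
  | succ N ih =>
    rw [Finset.sum_range_succ]
    have hpos : (0 : ℝ) < N + 1 := by positivity
    have h1 : (1 + (((N + 1 : ℕ) : ℤ) : ℝ) ^ 2) ^ (-(1 / 4) : ℝ) ≤ (Real.sqrt (N + 1))⁻¹ := by
      have : (Real.sqrt (N + 1))⁻¹ = (((N : ℝ) + 1) ^ 2) ^ (-(1 / 4) : ℝ) := by
        rw [Real.sqrt_eq_rpow, ← Real.rpow_neg hpos.le, ← Real.rpow_natCast,
          ← Real.rpow_mul hpos.le]
        norm_num
      rw [this]
      refine Real.rpow_le_rpow_of_nonpos (by positivity) ?_ (by norm_num)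
      push_cast; linarith
    have h2 : (Real.sqrt (N + 1))⁻¹ ≤ 2 * (Real.sqrt (N + 1) - Real.sqrt N) := by
      have hs : 0 < Real.sqrt (N + 1) := Real.sqrt_pos.2 hpos
      rw [inv_le_iff_one_le_mul₀ hs]
      have e1 : Real.sqrt (N + 1) ^ 2 = N + 1 := Real.sq_sqrt hpos.le
      have e2 : Real.sqrt N ^ 2 = N := Real.sq_sqrt (Nat.cast_nonneg N)
      nlinarith [sq_nonneg (Real.sqrt (N + 1) - Real.sqrt N)]
    push_cast at *
    linarith

theorem tsum_wt_neg_le (l : ℤ) :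
    ∑' m : ℤ, (if |m| ≤ |l| then wt (-(1 / 4)) m else 0) ≤ 5 * wt (1 / 4) l := by
  have hsupp : ∀ m ∉ Finset.Icc (-(l.natAbs : ℤ)) l.natAbs,
      (if |m| ≤ |l| then wt (-(1 / 4)) m else 0) = 0 := by
    intro m hm
    rw [if_neg]
    intro h
    rw [Int.abs_eq_natAbs l, abs_le] at h
    exact hm (Finset.mem_Icc.2 h)
  rw [tsum_eq_sum hsupp]
  calc ∑ m ∈ Finset.Icc (-(l.natAbs : ℤ)) l.natAbs, (if |m| ≤ |l| then wt (-(1 / 4)) m else 0)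
      ≤ ∑ m ∈ Finset.Icc (-(l.natAbs : ℤ)) l.natAbs, wt (-(1 / 4)) m :=
        Finset.sum_le_sum fun m _ => by split_ifs <;> simp
    _ = ENNReal.ofReal (∑ m ∈ Finset.Icc (-(l.natAbs : ℤ)) l.natAbs,
          (1 + (m : ℝ) ^ 2) ^ (-(1 / 4) : ℝ)) := by
        rw [ENNReal.ofReal_sum_of_nonneg fun m _ => by positivity]; rfl
    _ ≤ ENNReal.ofReal (5 * (1 + (l : ℝ) ^ 2) ^ (1 / 4 : ℝ)) := by
        refine ENNReal.ofReal_le_ofReal ?_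
        rw [Finset.sum_Icc_of_even_eq_range (by intro m; simp)]
        have h := sum_range_one_add_sq_rpow_le l.natAbs
        have habs : ((l.natAbs : ℕ) : ℝ) = |(l : ℝ)| := by
          rw [Nat.cast_natAbs]; push_cast; rfl
        have h1 : Real.sqrt (l.natAbs : ℕ) ≤ (1 + (l : ℝ) ^ 2) ^ (1 / 4 : ℝ) := by
          have : Real.sqrt (l.natAbs : ℕ) = ((l : ℝ) ^ 2) ^ (1 / 4 : ℝ) := by
            rw [habs, ← sq_abs, Real.sqrt_eq_rpow, ← Real.rpow_natCast,
              ← Real.rpow_mul (abs_nonneg _)]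
            norm_num
          rw [this]
          exact Real.rpow_le_rpow (by positivity) (by linarith) (by norm_num)
        have h2 : (1 : ℝ) ≤ (1 + (l : ℝ) ^ 2) ^ (1 / 4 : ℝ) :=
          Real.one_le_rpow (by nlinarith [sq_nonneg (l : ℝ)]) (by norm_num)
        simp only [nsmul_eq_mul, Int.cast_zero]
        norm_num at h ⊢
        norm_num at h1 h2
        linarith
    _ = 5 * wt (1 / 4) l := by
        rw [ENNReal.ofReal_mul (by norm_num), wt]; norm_num

/-- Discrete form of the embedding `H^{1/4} ⊂ L⁴`. -/
theorem tsum_selfConv_sq_le (u : ℤ → ENNReal)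
    (hfin : ∑' n, (∑' m, u m * u (n - m)) ^ 2 ≠ ⊤) :
    ∑' n, (∑' m, u m * u (n - m)) ^ 2 ≤ 20 * (∑' n, wt (1 / 4) n * u n ^ 2) ^ 2 := by
  set d : ℤ → ENNReal := fun n => ∑' m, u m * u (n - m) with hd
  set D := ∑' n, d n ^ 2 with hD
  set S := ∑' n, wt (1 / 4) n * u n ^ 2 with hS
  change D ≠ ⊤ at hfin
  set X := ∑' p : ℤ × ℤ, (if |p.1| ≤ |p.2| then d (p.1 + p.2) * (u p.1 * u p.2) else 0) with hX
  have hDX : D ≤ 2 * X := by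
    have e1 : D = ∑' p : ℤ × ℤ, d (p.1 + p.2) * (u p.1 * u p.2) := by
      rw [ENNReal.tsum_prod']
      calc D = ∑' n, ∑' m, d n * (u m * u (n - m)) := by
            refine tsum_congr fun n => ?_
            rw [ENNReal.tsum_mul_left, pow_two]
        _ = ∑' m, ∑' n, d n * (u m * u (n - m)) := ENNReal.tsum_comm
        _ = _ := by
            refine tsum_congr fun m => ?_
            rw [← (Equiv.addLeft m).tsum_eq]
            simp
    have e2 : ∑' p : ℤ × ℤ, (if |p.2| ≤ |p.1| then d (p.1 + p.2) * (u p.1 * u p.2) else 0) = X := by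
      rw [hX, ← (Equiv.prodComm ℤ ℤ).tsum_eq]
      refine tsum_congr fun p => ?_
      simp [add_comm, mul_comm]
    rw [two_mul]
    nth_rw 2 [← e2]
    rw [hX, e1, ← ENNReal.tsum_add]
    refine ENNReal.tsum_le_tsum fun p => ?_
    rcases le_total |p.1| |p.2| with h | h <;> simp [h]
  have hX2 : X ^ 2 ≤ S * D * (5 * S) := by
    have h := tsum_mul_sq_le (fun p : ℤ × ℤ => wt (1 / 8) p.1 * u p.1 * d (p.1 + p.2))
      fun p => (if |p.1| ≤ |p.2| then wt (-(1 / 8)) p.1 * u p.2 else 0)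
    have e0 : ∑' p : ℤ × ℤ, wt (1 / 8) p.1 * u p.1 * d (p.1 + p.2) *
        (if |p.1| ≤ |p.2| then wt (-(1 / 8)) p.1 * u p.2 else 0) = X := by
      refine tsum_congr fun p => ?_
      split_ifs
      · calc _ = (wt (1 / 8) p.1 * wt (-(1 / 8)) p.1) * (d (p.1 + p.2) * (u p.1 * u p.2)) := by ring
          _ = _ := by rw [wt_mul_wt, add_neg_cancel, wt_zero, one_mul]
      · simp
    have e1 : ∑' p : ℤ × ℤ, (wt (1 / 8) p.1 * u p.1 * d (p.1 + p.2)) ^ 2 = S * D := by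
      rw [ENNReal.tsum_prod', hS, ← ENNReal.tsum_mul_right]
      refine tsum_congr fun m => ?_
      simp only [mul_pow, wt_pow_two, ENNReal.tsum_mul_left]
      have hshift := (Equiv.addLeft m).tsum_eq fun n => d n ^ 2
      simp only [Equiv.coe_addLeft] at hshift
      rw [hshift, show (2 * (1 / 8) : ℝ) = 1 / 4 by norm_num, hD]
    have e2 : ∑' p : ℤ × ℤ, (if |p.1| ≤ |p.2| then wt (-(1 / 8)) p.1 * u p.2 else 0) ^ 2
        ≤ 5 * S := by
      rw [ENNReal.tsum_prod', ENNReal.tsum_comm, hS, ← ENNReal.tsum_mul_left]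
      refine ENNReal.tsum_le_tsum fun l => ?_
      calc ∑' m : ℤ, (if |m| ≤ |l| then wt (-(1 / 8)) m * u l else 0) ^ 2
          = ∑' m : ℤ, (if |m| ≤ |l| then wt (-(1 / 4)) m else 0) * u l ^ 2 := by
            refine tsum_congr fun m => ?_
            split_ifs
            · rw [mul_pow, wt_pow_two]; norm_num
            · simp
        _ ≤ 5 * wt (1 / 4) l * u l ^ 2 := by
            rw [ENNReal.tsum_mul_right]; gcongr; exact tsum_wt_neg_le l
        _ = _ := by ring
    rw [e0, e1] at h
    exact h.trans (mul_le_mul_right e2 _)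
  rcases eq_or_ne D 0 with h0 | h0
  · rw [h0]; exact zero_le
  · have : D * D ≤ D * (20 * S ^ 2) := by
      calc D * D ≤ (2 * X) * (2 * X) := mul_le_mul' hDX hDX
        _ = 4 * X ^ 2 := by ring
        _ ≤ 4 * (S * D * (5 * S)) := by gcongr
        _ = _ := by ring
    exact (ENNReal.mul_le_mul_iff_right h0 hfin).1 this

theorem summable_and_tsum_shear {G : Type*} [AddCommGroup G] {P : G × G → ℂ}
    (hP : Summable fun p => ‖P p‖) {e : G → ℂ} (he : ∀ g, ‖e g‖ = 1) :
    (Summable fun n => ‖∑' k, P (k, n - k)‖) ∧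
      ∑' p : G × G, P p * e (p.1 + p.2) = ∑' n, (∑' k, P (k, n - k)) * e n := by
  let φ : G × G ≃ G × G :=
    { toFun := fun p => (p.2, p.1 - p.2)
      invFun := fun p => (p.1 + p.2, p.1)
      left_inv := fun p => by simp
      right_inv := fun p => by simp }
  have h1 : Summable fun p : G × G => ‖P (p.2, p.1 - p.2)‖ := φ.summable_iff.2 hP
  constructor
  · have h2 := h1.prod
    refine Summable.of_nonneg_of_le (fun n => norm_nonneg _) (fun n => ?_) h2
    exact norm_tsum_le_tsum_norm (h1.prod_factor n)
  · rw [← φ.tsum_eq]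
    have h2 : Summable fun p : G × G => P (p.2, p.1 - p.2) * e p.1 :=
      Summable.of_norm (by simpa [norm_mul, he] using h1)
    have : ∀ p : G × G, P (φ p) * e ((φ p).1 + (φ p).2) = P (p.2, p.1 - p.2) * e p.1 := by
      intro p; simp [φ]
    simp only [this]
    rw [h2.tsum_prod]
    refine tsum_congr fun n => ?_
    change ∑' k, P (k, n - k) * e n = _
    rw [tsum_mul_right]

theorem tsum_enorm_ne_top {ι : Type*} {c : ι → ℂ} (hc : Summable fun n => ‖c n‖) :
    ∑' n, ‖c n‖ₑ ≠ ⊤ := by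
  simp only [← ofReal_norm]
  exact hc.tsum_ofReal_ne_top

/-- The embedding `H^{1/4}(𝕋) ⊂ L⁴(𝕋)` for absolutely convergent Fourier series. -/
theorem lintegral_enorm_pow_four_tsum_chr_le {c : ℤ → ℂ} (hc : Summable fun n => ‖c n‖) :
    ∫⁻ x in I2pi, (‖∑' n, c n * chr n x‖ₑ ^ 2) ^ 2 ≤
      ENNReal.ofReal (2 * π) * 20 * (∑' n, wt (1 / 4) n * ‖c n‖ₑ ^ 2) ^ 2 := by
  have hP : Summable fun p : ℤ × ℤ => ‖c p.1 * c p.2‖ := by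
    simpa only [norm_mul] using hc.mul_of_nonneg hc (fun n => norm_nonneg _) fun n => norm_nonneg _
  have hsum := (summable_and_tsum_shear hP (norm_chr · 0)).1
  have hsq : ∀ x, (∑' n, c n * chr n x) ^ 2 = ∑' n, (∑' k, c k * c (n - k)) * chr n x := by
    intro x
    have h1 := summable_mul_unimodular (norm_chr · x) hc
    rw [← (summable_and_tsum_shear hP (norm_chr · x)).2, pow_two,
      tsum_mul_tsum_of_summable_norm h1.norm h1.norm]
    refine tsum_congr fun p => ?_
    rw [chr_add]; ring
  have hmain := lintegral_enorm_sq_tsum_chr hsum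
  simp only [← hsq, enorm_pow] at hmain
  rw [hmain, mul_assoc]
  gcongr
  have hle : ∀ n, ‖∑' k, c k * c (n - k)‖ₑ ≤ ∑' k, ‖c k‖ₑ * ‖c (n - k)‖ₑ := fun n => by
    refine enorm_tsum_le_tsum_enorm.trans_eq ?_
    simp only [enorm_mul]
  refine (ENNReal.tsum_le_tsum fun n => pow_le_pow_left' (hle n) 2).trans ?_
  refine tsum_selfConv_sq_le (fun n => ‖c n‖ₑ) (ne_top_of_le_ne_top ?_
    (tsum_conv_sq_le (fun n => ‖c n‖ₑ) fun n => ‖c n‖ₑ))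
  have h2 := tsum_enorm_ne_top (c := fun n => c n ^ 2)
    (by simpa [norm_pow] using summable_sq_of_summable hc)
  simp only [enorm_pow] at h2
  exact ENNReal.mul_ne_top (ENNReal.pow_ne_top (tsum_enorm_ne_top hc)) h2

theorem IsDyadicPartition.blockSymb_nonneg {χ θ : ℝ → ℝ}
    (hp : IsDyadicPartition χ θ) (j : ℤ) (z : ℝ) : 0 ≤ blockSymb χ θ j z := by
  unfold blockSymb
  split_ifs
  exacts [hp.nonneg_chi _, hp.nonneg_theta _, le_rfl]

theorem IsDyadicPartition.hasSum_blockSymb {χ θ : ℝ → ℝ}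
    (hp : IsDyadicPartition χ θ) (z : ℝ) : HasSum (fun j => blockSymb χ θ j z) 1 := by
  have hsum : Summable fun j : ℕ => θ ((2 : ℝ) ^ (-(j : ℤ)) * |z|) := by
    obtain ⟨r, R, hr, -, hθ⟩ := hp.theta_support
    obtain ⟨N, hN⟩ := pow_unbounded_of_one_lt (|z| / r) (one_lt_two (α := ℝ))
    refine summable_of_ne_finset_zero (s := Finset.range N) fun j hj => ?_
    have hj' : N ≤ j := by simpa using hj
    refine hθ _ (Or.inl ?_)
    have h2 : (2 : ℝ) ^ N ≤ 2 ^ j := pow_le_pow_right₀ one_le_two hj'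
    have h3 : |z| < r * 2 ^ j := by
      rw [div_lt_iff₀ hr] at hN
      nlinarith
    rw [abs_of_nonneg (by positivity), zpow_neg, zpow_natCast, inv_mul_lt_iff₀ (by positivity)]
    linarith
  have h1 : HasSum (fun j : ℤ => if j = -1 then χ |z| else 0) (χ |z|) := hasSum_ite_eq _ _
  have h2 : HasSum (fun j : ℤ => if 0 ≤ j then θ ((2 : ℝ) ^ (-j) * |z|) else 0)
      (∑' j : ℕ, θ ((2 : ℝ) ^ (-(j : ℤ)) * |z|)) := by
    rw [← Function.Injective.hasSum_iff (Nat.cast_injective (R := ℤ))]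
    · simpa [Function.comp_def] using hsum.hasSum
    · intro j hj
      rw [if_neg]
      intro h
      exact hj ⟨j.toNat, Int.toNat_of_nonneg h⟩
  have h := h1.add h2
  rw [hp.partition] at h
  refine h.congr_fun ?_
  intro j
  unfold blockSymb
  by_cases hj : j = -1
  · subst hj; simp
  · simp [hj]

theorem IsDyadicPartition.blockSymb_le_one {χ θ : ℝ → ℝ}
    (hp : IsDyadicPartition χ θ) (j : ℤ) (z : ℝ) : blockSymb χ θ j z ≤ 1 :=
  le_hasSum (hp.hasSum_blockSymb z) j fun i _ => hp.blockSymb_nonneg i z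

theorem IsDyadicPartition.lowSymb_nonneg {χ θ : ℝ → ℝ}
    (hp : IsDyadicPartition χ θ) (j : ℤ) (z : ℝ) : 0 ≤ lowSymb χ θ j z :=
  Finset.sum_nonneg fun i _ => hp.blockSymb_nonneg i z

theorem IsDyadicPartition.lowSymb_le_one {χ θ : ℝ → ℝ}
    (hp : IsDyadicPartition χ θ) (j : ℤ) (z : ℝ) : lowSymb χ θ j z ≤ 1 :=
  sum_le_hasSum _ (fun i _ => hp.blockSymb_nonneg i z) (hp.hasSum_blockSymb z)

theorem IsDyadicPartition.exists_support_bound {χ θ : ℝ → ℝ}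
    (hp : IsDyadicPartition χ θ) : ∃ R : ℝ, 1 ≤ R ∧ ∀ j n : ℤ,
    blockSymb χ θ j n ≠ 0 → ((2 : ℝ) ^ j) ^ 2 ≤ R ^ 2 * (1 + (n : ℝ) ^ 2) ∧
      |(n : ℝ)| ≤ R * 2 ^ j := by
  obtain ⟨R₀, hR₀, hχ⟩ := hp.chi_support
  obtain ⟨r, R₁, hr, hrR, hθ⟩ := hp.theta_support
  set R := 1 + 2 * R₀ + R₁ + 1 / r with hR
  have hr' : 0 < 1 / r := by positivity
  refine ⟨R, by linarith, fun j n h => ?_⟩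
  unfold blockSymb at h
  split_ifs at h with h1 h2
  · subst h1
    have hn : |(n : ℝ)| < R₀ := by
      by_contra hcon
      exact h (hχ _ (by rw [abs_abs]; linarith))
    norm_num
    constructor
    · nlinarith [sq_nonneg (n : ℝ), sq_nonneg (R * n)]
    · linarith
  · have hpos : (0 : ℝ) < 2 ^ j := by positivity
    have hnot : ¬(|((2 : ℝ) ^ (-j) * |(n : ℝ)|)| < r ∨ R₁ < |((2 : ℝ) ^ (-j) * |(n : ℝ)|)|) :=
      fun hcon => h (hθ _ hcon)
    rw [not_or, not_lt, not_lt, abs_of_nonneg (by positivity), zpow_neg, inv_mul_le_iff₀ hpos,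
      le_inv_mul_iff₀ hpos] at hnot
    obtain ⟨hl, hu⟩ := hnot
    constructor
    · have h3 : (2 : ℝ) ^ j ≤ 1 / r * |(n : ℝ)| := by
        rw [one_div, le_inv_mul_iff₀ hr]; linarith
      have h4 : (2 : ℝ) ^ j ≤ R * |(n : ℝ)| :=
        h3.trans (mul_le_mul_of_nonneg_right (by linarith) (abs_nonneg _))
      have h5 := pow_le_pow_left₀ hpos.le h4 2
      rw [mul_pow, sq_abs] at h5
      nlinarith [sq_nonneg R]
    · nlinarith
  · exact absurd rfl h

theorem IsDyadicPartition.exists_lowSymb_mul_blockSymb_bound {χ θ : ℝ → ℝ}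
    (hp : IsDyadicPartition χ θ) : ∃ D : ℝ, 1 ≤ D ∧ ∀ j m l : ℤ,
    lowSymb χ θ (j - 1) m * blockSymb χ θ j l ≠ 0 →
      1 + (((m + l : ℤ) : ℤ) : ℝ) ^ 2 ≤ D * (1 + (l : ℝ) ^ 2) := by
  obtain ⟨R, hR, h⟩ := hp.exists_support_bound
  refine ⟨2 * R ^ 4 + 3, by nlinarith [sq_nonneg (R ^ 2)], fun j m l hne => ?_⟩
  obtain ⟨hm, hl⟩ := mul_ne_zero_iff.1 hne
  obtain ⟨i, hi, him⟩ := Finset.exists_ne_zero_of_sum_ne_zero hm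
  have h1 := (h i m him).2
  have h2 := (h j l hl).1
  have hij : (2 : ℝ) ^ i ≤ 2 ^ j :=
    zpow_le_zpow_right₀ one_le_two (by have := (Finset.mem_Icc.1 hi).2; lia)
  have h3 : |(m : ℝ)| ≤ R * 2 ^ j := h1.trans (mul_le_mul_of_nonneg_left hij (by linarith))
  have h4 := pow_le_pow_left₀ (abs_nonneg _) h3 2
  rw [sq_abs, mul_pow] at h4
  have h5 : R ^ 2 * ((2 : ℝ) ^ j) ^ 2 ≤ R ^ 2 * (R ^ 2 * (1 + (l : ℝ) ^ 2)) :=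
    mul_le_mul_of_nonneg_left h2 (sq_nonneg _)
  push_cast
  nlinarith [sq_nonneg ((m : ℝ) - l)]

theorem IsDyadicPartition.exists_sum_blockSymb_bound {χ θ : ℝ → ℝ}
    (hp : IsDyadicPartition χ θ) {s : ℝ} (hs : 0 ≤ s) :
    ∃ B : ℝ, 0 < B ∧ ∀ (K : Finset {j : ℤ // -1 ≤ j}) (n : ℤ),
      ∑ k ∈ K, (2 : ℝ) ^ (2 * (k.1 : ℝ) * s) * blockSymb χ θ k.1 n ^ 2 ≤
        B * (1 + (n : ℝ) ^ 2) ^ s := by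
  obtain ⟨R, hR, h⟩ := hp.exists_support_bound
  refine ⟨(R ^ 2) ^ s, by positivity, fun K n => ?_⟩
  calc ∑ k ∈ K, (2 : ℝ) ^ (2 * (k.1 : ℝ) * s) * blockSymb χ θ k.1 n ^ 2
      ≤ ∑ k ∈ K, ((R ^ 2) ^ s * (1 + (n : ℝ) ^ 2) ^ s) * blockSymb χ θ k.1 n := by
        refine Finset.sum_le_sum fun k _ => ?_
        have h0 := hp.blockSymb_nonneg k.1 n
        have h1 := hp.blockSymb_le_one k.1 n
        rcases eq_or_ne (blockSymb χ θ k.1 n) 0 with hz | hz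
        · simp [hz]
        · have h2 := (h _ _ hz).1
          have h3 : (2 : ℝ) ^ (2 * (k.1 : ℝ) * s) ≤ (R ^ 2) ^ s * (1 + (n : ℝ) ^ 2) ^ s := by
            rw [← Real.mul_rpow (by positivity) (by positivity), Real.rpow_mul two_pos.le]
            refine Real.rpow_le_rpow (by positivity) ?_ hs
            rwa [mul_comm, Real.rpow_mul two_pos.le, Real.rpow_intCast, Real.rpow_two]
          exact mul_le_mul h3 (by nlinarith) (by positivity) (by positivity)
    _ = ((R ^ 2) ^ s * (1 + (n : ℝ) ^ 2) ^ s) * ∑ k ∈ K, blockSymb χ θ k.1 n := by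
        rw [Finset.mul_sum]
    _ ≤ ((R ^ 2) ^ s * (1 + (n : ℝ) ^ 2) ^ s) * 1 := by
        gcongr
        have := sum_le_hasSum (K.map (Function.Embedding.subtype _))
          (fun i _ => hp.blockSymb_nonneg i n) (hp.hasSum_blockSymb n)
        simpa using this
    _ = _ := mul_one _

/-- The bilinear symbol of the vertical paraproduct. -/
def paraSymb (χ θ : ℝ → ℝ) (m l : ℤ) : ℝ :=
  ∑' j : ℤ, lowSymb χ θ (j - 1) m * blockSymb χ θ j l

theorem IsDyadicPartition.paraTerm_nonneg {χ θ : ℝ → ℝ}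
    (hp : IsDyadicPartition χ θ) (j m l : ℤ) :
    0 ≤ lowSymb χ θ (j - 1) m * blockSymb χ θ j l :=
  mul_nonneg (hp.lowSymb_nonneg _ _) (hp.blockSymb_nonneg _ _)

theorem IsDyadicPartition.paraTerm_le {χ θ : ℝ → ℝ}
    (hp : IsDyadicPartition χ θ) (j m l : ℤ) :
    lowSymb χ θ (j - 1) m * blockSymb χ θ j l ≤ blockSymb χ θ j l :=
  mul_le_of_le_one_left (hp.blockSymb_nonneg _ _) (hp.lowSymb_le_one _ _)

theorem IsDyadicPartition.summable_paraTerm {χ θ : ℝ → ℝ}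
    (hp : IsDyadicPartition χ θ) (m l : ℤ) :
    Summable fun j : ℤ => lowSymb χ θ (j - 1) m * blockSymb χ θ j l :=
  Summable.of_nonneg_of_le (fun j => hp.paraTerm_nonneg j m l) (fun j => hp.paraTerm_le j m l)
    (hp.hasSum_blockSymb l).summable

theorem IsDyadicPartition.paraSymb_nonneg {χ θ : ℝ → ℝ}
    (hp : IsDyadicPartition χ θ) (m l : ℤ) : 0 ≤ paraSymb χ θ m l :=
  tsum_nonneg fun j => hp.paraTerm_nonneg j m l

theorem IsDyadicPartition.paraSymb_le_one {χ θ : ℝ → ℝ}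
    (hp : IsDyadicPartition χ θ) (m l : ℤ) : paraSymb χ θ m l ≤ 1 :=
  ((hp.summable_paraTerm m l).tsum_le_tsum (fun j => hp.paraTerm_le j m l)
    (hp.hasSum_blockSymb l).summable).trans_eq (hp.hasSum_blockSymb l).tsum_eq

theorem IsDyadicPartition.exists_paraSymb_bound {χ θ : ℝ → ℝ}
    (hp : IsDyadicPartition χ θ) : ∃ D : ℝ, 1 ≤ D ∧ ∀ m l : ℤ,
    paraSymb χ θ m l ≠ 0 → 1 + (((m + l : ℤ) : ℤ) : ℝ) ^ 2 ≤ D * (1 + (l : ℝ) ^ 2) := by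
  obtain ⟨D, hD, h⟩ := hp.exists_lowSymb_mul_blockSymb_bound
  refine ⟨D, hD, fun m l hne => ?_⟩
  by_contra hcon
  refine hne ?_
  have : ∀ j : ℤ, lowSymb χ θ (j - 1) m * blockSymb χ θ j l = 0 := fun j => by
    by_contra hj
    exact hcon (h j m l hj)
  simp [paraSymb, this]

theorem IsDyadicPartition.summable_paraSymb_mul {χ θ : ℝ → ℝ}
    (hp : IsDyadicPartition χ θ) {G : Type*} {c d : G → ℂ}
    (hc : Summable fun g => ‖c g‖) (hd : Summable fun g => ‖d g‖) (v : G → ℤ) :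
    Summable fun p : G × G => ‖(paraSymb χ θ (v p.1) (v p.2) : ℂ) * c p.1 * d p.2‖ := by
  refine Summable.of_nonneg_of_le (fun _ => norm_nonneg _) (fun p => ?_)
    (hc.mul_of_nonneg hd (fun n => norm_nonneg _) fun n => norm_nonneg _)
  rw [norm_mul, norm_mul, Complex.norm_of_nonneg (hp.paraSymb_nonneg _ _), mul_assoc]
  exact mul_le_of_le_one_left (by positivity) (hp.paraSymb_le_one _ _)

theorem IsDyadicPartition.summable_paraTerm_mul {χ θ : ℝ → ℝ}
    (hp : IsDyadicPartition χ θ) {ι : Type*} {b : ι → ℝ} (hb : Summable b)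
    (hb0 : ∀ i, 0 ≤ b i) (m l : ι → ℤ) : Summable fun q : ι × ℤ =>
      lowSymb χ θ (q.2 - 1) (m q.1) * blockSymb χ θ q.2 (l q.1) * b q.1 := by
  have h0 : ∀ q : ι × ℤ,
      0 ≤ lowSymb χ θ (q.2 - 1) (m q.1) * blockSymb χ θ q.2 (l q.1) * b q.1 := fun q =>
    mul_nonneg (hp.paraTerm_nonneg q.2 (m q.1) (l q.1)) (hb0 _)
  refine (summable_prod_of_nonneg h0).2
    ⟨fun p => (hp.summable_paraTerm (m p) (l p)).mul_right (b p), ?_⟩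
  refine Summable.of_nonneg_of_le (fun p => tsum_nonneg fun j => h0 (p, j)) (fun p => ?_) hb
  dsimp only
  rw [tsum_mul_right]
  exact mul_le_of_le_one_left (hb0 p) (hp.paraSymb_le_one _ _)

/-- The paraproduct of two absolutely convergent character series is again such a series. -/
theorem IsDyadicPartition.tsum_paraproduct {χ θ : ℝ → ℝ}
    (hp : IsDyadicPartition χ θ) {G : Type*} [AddCommGroup G] {c d e : G → ℂ}
    (hc : Summable fun g => ‖c g‖) (hd : Summable fun g => ‖d g‖) (he : ∀ g, ‖e g‖ = 1)
    (hadd : ∀ g h, e (g + h) = e g * e h) (v : G → ℤ) :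
    ∑' j : ℤ, (∑' g, (lowSymb χ θ (j - 1) (v g) : ℂ) * c g * e g) *
        (∑' g, (blockSymb χ θ j (v g) : ℂ) * d g * e g) =
      ∑' n, (∑' k, (paraSymb χ θ (v k) (v (n - k)) : ℂ) * c k * d (n - k)) * e n := by
  have hnorm : ∀ (f : G → ℂ) (w : G → ℝ), (∀ g, 0 ≤ w g) → (∀ g, w g ≤ 1) →
      (Summable fun g => ‖f g‖) → Summable fun g => ‖(w g : ℂ) * f g * e g‖ := by
    intro f w hw0 hw1 hf
    refine Summable.of_nonneg_of_le (fun _ => norm_nonneg _) (fun g => ?_) hf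
    rw [norm_mul, norm_mul, he, mul_one, Complex.norm_of_nonneg (hw0 g)]
    exact mul_le_of_le_one_left (norm_nonneg _) (hw1 g)
  have hprod : ∀ j : ℤ, (∑' g, (lowSymb χ θ (j - 1) (v g) : ℂ) * c g * e g) *
        (∑' g, (blockSymb χ θ j (v g) : ℂ) * d g * e g) =
      ∑' p : G × G, ((lowSymb χ θ (j - 1) (v p.1) * blockSymb χ θ j (v p.2) : ℝ) : ℂ) *
        (c p.1 * d p.2 * e (p.1 + p.2)) := by
    intro j
    rw [tsum_mul_tsum_of_summable_norm
      (hnorm c (fun g => lowSymb χ θ (j - 1) (v g)) (fun g => hp.lowSymb_nonneg _ _)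
        (fun g => hp.lowSymb_le_one _ _) hc)
      (hnorm d (fun g => blockSymb χ θ j (v g)) (fun g => hp.blockSymb_nonneg _ _)
        (fun g => hp.blockSymb_le_one _ _) hd)]
    refine tsum_congr fun p => ?_
    rw [hadd]; push_cast; ring
  simp only [hprod]
  have hsum : Summable fun q : (G × G) × ℤ =>
      ((lowSymb χ θ (q.2 - 1) (v q.1.1) * blockSymb χ θ q.2 (v q.1.2) : ℝ) : ℂ) *
        (c q.1.1 * d q.1.2 * e (q.1.1 + q.1.2)) := by
    have hb : Summable fun p : G × G => ‖c p.1‖ * ‖d p.2‖ :=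
      hc.mul_of_nonneg hd (fun n => norm_nonneg (c n)) fun n => norm_nonneg (d n)
    have h := hp.summable_paraTerm_mul hb (fun q => by positivity)
      (fun p : G × G => v p.1) (fun p : G × G => v p.2)
    refine Summable.of_norm_bounded h fun q => ?_
    rw [norm_mul, Complex.norm_of_nonneg (hp.paraTerm_nonneg q.2 (v q.1.1) (v q.1.2)), norm_mul,
      norm_mul, he, mul_one]
  have hcomm := Summable.tsum_comm (f := fun (p : G × G) (j : ℤ) =>
    ((lowSymb χ θ (j - 1) (v p.1) * blockSymb χ θ j (v p.2) : ℝ) : ℂ) *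
        (c p.1 * d p.2 * e (p.1 + p.2))) hsum
  rw [hcomm, ← (summable_and_tsum_shear (hp.summable_paraSymb_mul hc hd v) he).2]
  refine tsum_congr fun p => ?_
  rw [tsum_mul_right, ← Complex.ofReal_tsum, ← paraSymb]
  ring

/-- The partial Fourier series in the horizontal variable. -/
def slice (c : ℤ × ℤ → ℂ) (m : ℤ) (x : ℝ) : ℂ := ∑' k : ℤ, c (k, m) * chr k x

theorem summable_norm_col {c : ℤ × ℤ → ℂ} (hc : Summable fun k => ‖c k‖) (m : ℤ) :
    Summable fun k : ℤ => ‖c (k, m)‖ :=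
  hc.prod_symm.prod_factor m

theorem continuous_slice {c : ℤ × ℤ → ℂ} (hc : Summable fun k => ‖c k‖) (m : ℤ) :
    Continuous (slice c m) :=
  continuous_tsum_chr (summable_norm_col hc m)

theorem summable_norm_slice {c : ℤ × ℤ → ℂ} (hc : Summable fun k => ‖c k‖) (x : ℝ) :
    Summable fun m => ‖slice c m x‖ := by
  refine Summable.of_nonneg_of_le (fun _ => norm_nonneg _) (fun m => ?_) hc.prod_symm.prod
  have h : ∀ k : ℤ, ‖c (k, m) * chr k x‖ = ‖c (k, m)‖ := fun k => by
    rw [norm_mul, norm_chr, mul_one]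
  refine (norm_tsum_le_tsum_norm ?_).trans_eq (tsum_congr h)
  simpa only [h] using summable_norm_col hc m

theorem slice_mul (w : ℤ → ℂ) (c : ℤ × ℤ → ℂ) (m : ℤ) (x : ℝ) :
    slice (fun k => w k.2 * c k) m x = w m * slice c m x := by
  simp only [slice, mul_assoc, tsum_mul_left]

theorem tsum_eK_eq_tsum_slice {c : ℤ × ℤ → ℂ} (hc : Summable fun k => ‖c k‖) (x : ℝ × ℝ) :
    ∑' k, c k * eK k x = ∑' m, slice c m x.1 * chr m x.2 := by
  have hs : Summable fun k => c k * eK k x := summable_mul_unimodular (fun k => norm_eK k x) hc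
  rw [← (Equiv.prodComm ℤ ℤ).tsum_eq]
  refine (Summable.tsum_prod hs.prod_symm).trans (tsum_congr fun m => ?_)
  rw [slice, ← tsum_mul_right]
  refine tsum_congr fun k => ?_
  simp only [Prod.swap_prod_mk, eK_eq]
  ring

theorem summable_norm_mul_of_le_one {ι : Type*} {w : ι → ℝ} (hw0 : ∀ i, 0 ≤ w i)
    (hw1 : ∀ i, w i ≤ 1) {c : ι → ℂ} (hc : Summable fun i => ‖c i‖) :
    Summable fun i => ‖(w i : ℂ) * c i‖ := by
  refine Summable.of_nonneg_of_le (fun _ => norm_nonneg _) (fun i => ?_) hc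
  rw [norm_mul, Complex.norm_of_nonneg (hw0 i)]
  exact mul_le_of_le_one_left (norm_nonneg _) (hw1 i)

theorem eq_of_tsum_chr_eq {c d : ℤ → ℂ} (hc : Summable fun n => ‖c n‖)
    (hd : Summable fun n => ‖d n‖) (h : ∀ x, ∑' n, c n * chr n x = ∑' n, d n * chr n x) :
    c = d := by
  funext m
  have h1 := integral_tsum_chr_mul_chr_neg hc m
  simp only [h] at h1
  rw [integral_tsum_chr_mul_chr_neg hd m] at h1
  have : (2 * π : ℂ) ≠ 0 := by
    exact_mod_cast Real.two_pi_pos.ne'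
  exact (mul_left_cancel₀ this h1).symm

/-- Fourier coefficients of the vertical paraproduct of two series with coefficients `c`, `d`. -/
def paraCoef (χ θ : ℝ → ℝ) (c d : ℤ × ℤ → ℂ) (n : ℤ × ℤ) : ℂ :=
  ∑' k : ℤ × ℤ, (paraSymb χ θ k.2 (n - k).2 : ℂ) * c k * d (n - k)

theorem IsDyadicPartition.summable_norm_paraCoef {χ θ : ℝ → ℝ}
    (hp : IsDyadicPartition χ θ) {c d : ℤ × ℤ → ℂ} (hc : Summable fun k => ‖c k‖)
    (hd : Summable fun k => ‖d k‖) : Summable fun n => ‖paraCoef χ θ c d n‖ :=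
  (summable_and_tsum_shear (hp.summable_paraSymb_mul hc hd Prod.snd) (e := fun _ => 1)
    (by simp)).1

theorem IsDyadicPartition.tsum_paraCoef {χ θ : ℝ → ℝ}
    (hp : IsDyadicPartition χ θ) {c d : ℤ × ℤ → ℂ} (hc : Summable fun k => ‖c k‖)
    (hd : Summable fun k => ‖d k‖) (x : ℝ × ℝ) :
    ∑' j : ℤ, (∑' k : ℤ × ℤ, (lowSymb χ θ (j - 1) k.2 : ℂ) * c k * eK k x) *
        (∑' k : ℤ × ℤ, (blockSymb χ θ j k.2 : ℂ) * d k * eK k x) =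
      ∑' n, paraCoef χ θ c d n * eK n x :=
  hp.tsum_paraproduct hc hd (fun k => norm_eK k x) (fun k l => eK_add k l x) Prod.snd

theorem IsDyadicPartition.slice_paraCoef {χ θ : ℝ → ℝ}
    (hp : IsDyadicPartition χ θ) {c d : ℤ × ℤ → ℂ} (hc : Summable fun k => ‖c k‖)
    (hd : Summable fun k => ‖d k‖) (n : ℤ) (x : ℝ) :
    slice (paraCoef χ θ c d) n x =
      ∑' m, (paraSymb χ θ m (n - m) : ℂ) * slice c m x * slice d (n - m) x := by
  have hcx := summable_norm_slice hc x
  have hdx := summable_norm_slice hd x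
  refine congrFun (eq_of_tsum_chr_eq (c := fun n => slice (paraCoef χ θ c d) n x)
    (d := fun n => ∑' m, (paraSymb χ θ m (n - m) : ℂ) * slice c m x * slice d (n - m) x)
    (summable_norm_slice (hp.summable_norm_paraCoef hc hd) x)
    (summable_and_tsum_shear (hp.summable_paraSymb_mul hcx hdx id) (e := fun _ => 1)
      (by simp)).1 fun y => ?_) n
  rw [← tsum_eK_eq_tsum_slice (hp.summable_norm_paraCoef hc hd) (x, y),
    ← hp.tsum_paraCoef hc hd]
  refine Eq.trans ?_ (hp.tsum_paraproduct hcx hdx (fun k => norm_chr k y)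
    (fun k l => chr_add k l y) id)
  refine tsum_congr fun j => ?_
  rw [tsum_eK_eq_tsum_slice (summable_norm_mul_of_le_one (fun k => hp.lowSymb_nonneg _ _)
      (fun k => hp.lowSymb_le_one _ _) hc) (x, y),
    tsum_eK_eq_tsum_slice (summable_norm_mul_of_le_one (fun k => hp.blockSymb_nonneg _ _)
      (fun k => hp.blockSymb_le_one _ _) hd) (x, y)]
  simp only [slice_mul (fun m => (lowSymb χ θ (j - 1) m : ℂ)),
    slice_mul (fun m => (blockSymb χ θ j m : ℂ)), id]

theorem IsDyadicPartition.Tv_eq {χ θ : ℝ → ℝ} (hp : IsDyadicPartition χ θ) {a g : ℝ × ℝ → ℝ}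
    (ha : Summable fun k => ‖fc a k‖) (hg : Summable fun k => ‖fc g k‖) :
    Tv χ θ a g = fun x => ∑' n, paraCoef χ θ (fc a) (fc g) n * eK n x :=
  funext fun x => hp.tsum_paraCoef ha hg x

theorem IsDyadicPartition.LPC_Tv_eq {χ θ : ℝ → ℝ} (hp : IsDyadicPartition χ θ)
    {a g : ℝ × ℝ → ℝ} (ha : Summable fun k => ‖fc a k‖) (hg : Summable fun k => ‖fc g k‖)
    (j : ℤ) : LPC χ θ j (Tv χ θ a g) =
      fun x => ∑' n : ℤ × ℤ,
        ((blockSymb χ θ j n.2 : ℂ) * paraCoef χ θ (fc a) (fc g) n) * eK n x := by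
  funext x
  rw [hp.Tv_eq ha hg]
  simp only [LPC, fcC_tsum_eK (hp.summable_norm_paraCoef ha hg)]

theorem IsDyadicPartition.continuous_LPC_Tv {χ θ : ℝ → ℝ} (hp : IsDyadicPartition χ θ)
    {a g : ℝ × ℝ → ℝ} (ha : Summable fun k => ‖fc a k‖) (hg : Summable fun k => ‖fc g k‖)
    (j : ℤ) : Continuous (LPC χ θ j (Tv χ θ a g)) := by
  rw [hp.LPC_Tv_eq ha hg]
  exact continuous_tsum_eK (summable_norm_mul_of_le_one (fun k => hp.blockSymb_nonneg _ _)
    (fun k => hp.blockSymb_le_one _ _) (hp.summable_norm_paraCoef ha hg))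

theorem IsDyadicPartition.LPC_Tv_eq_slice {χ θ : ℝ → ℝ} (hp : IsDyadicPartition χ θ)
    {a g : ℝ × ℝ → ℝ} (ha : Summable fun k => ‖fc a k‖) (hg : Summable fun k => ‖fc g k‖)
    (j : ℤ) (x : ℝ × ℝ) : LPC χ θ j (Tv χ θ a g) x =
      ∑' n : ℤ, ((blockSymb χ θ j n : ℂ) * slice (paraCoef χ θ (fc a) (fc g)) n x.1) *
        chr n x.2 := by
  rw [hp.LPC_Tv_eq ha hg]
  dsimp only
  rw [tsum_eK_eq_tsum_slice (summable_norm_mul_of_le_one (fun k => hp.blockSymb_nonneg _ _)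
    (fun k => hp.blockSymb_le_one _ _) (hp.summable_norm_paraCoef ha hg)) x]
  simp only [slice_mul (fun m => (blockSymb χ θ j m : ℂ))]

theorem lintegral_mul_le_of_lintegral_sq_le {X : Type*} [MeasurableSpace X] {μ : Measure X}
    {f g : X → ENNReal} (hf : AEMeasurable f μ) (hg : AEMeasurable g μ) {C b b' : ENNReal}
    (h : ∫⁻ x, f x ^ 2 ∂μ ≤ C * b ^ 2) (h' : ∫⁻ x, g x ^ 2 ∂μ ≤ C * b' ^ 2) :
    ∫⁻ x, f x * g x ∂μ ≤ C * (b * b') := by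
  have key := ENNReal.lintegral_mul_le_Lp_mul_Lq μ Real.HolderConjugate.two_two hf hg
  simp only [ENNReal.rpow_two] at key
  refine key.trans ((mul_le_mul' (ENNReal.rpow_le_rpow h (by norm_num))
    (ENNReal.rpow_le_rpow h' (by norm_num))).trans_eq ?_)
  rw [← ENNReal.mul_rpow_of_nonneg _ _ (by norm_num : (0 : ℝ) ≤ 1 / 2),
    show C * b ^ 2 * (C * b' ^ 2) = (C * (b * b')) ^ 2 by ring, ← ENNReal.rpow_two,
    ← ENNReal.rpow_mul]
  norm_num

theorem lintegral_tsum_sq_le {X ι : Type*} [MeasurableSpace X] [Countable ι] {μ : Measure X}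
    {f : ι → X → ENNReal} (hf : ∀ i, AEMeasurable (f i) μ) {C : ENNReal} {b : ι → ENNReal}
    (h : ∀ i, ∫⁻ x, f i x ^ 2 ∂μ ≤ C * b i ^ 2) :
    ∫⁻ x, (∑' i, f i x) ^ 2 ∂μ ≤ C * (∑' i, b i) ^ 2 := by
  have hm : ∀ i j, AEMeasurable (fun x => f j x * f i x) μ := fun i j => (hf j).mul (hf i)
  simp only [sq (∑' _, _), ← ENNReal.tsum_mul_left, ← ENNReal.tsum_mul_right]
  rw [lintegral_tsum fun i => AEMeasurable.tsum fun j => hm i j]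
  refine ENNReal.tsum_le_tsum fun i => ?_
  rw [lintegral_tsum fun j => hm i j]
  exact ENNReal.tsum_le_tsum fun j => lintegral_mul_le_of_lintegral_sq_le (hf j) (hf i) (h j) (h i)

theorem lintegral_tsum_slice_sq_le {c : ℤ × ℤ → ℂ} (hc : Summable fun k => ‖c k‖) (s : ℝ) :
    ∫⁻ x in I2pi, (∑' m, wt s m * ‖slice c m x‖ₑ ^ 2) ^ 2 ≤
      ENNReal.ofReal (2 * π) * 20 *
        (∑' m, wt s m * ∑' k, wt (1 / 4) k * ‖c (k, m)‖ₑ ^ 2) ^ 2 := by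
  refine lintegral_tsum_sq_le (fun m => ?_) fun m => ?_
  · exact ((continuous_slice hc m).enorm.measurable.pow_const 2).const_mul _ |>.aemeasurable
  · simp only [mul_pow (wt s m)]
    rw [lintegral_const_mul' _ _ (by simp [wt]), mul_left_comm]
    gcongr
    exact lintegral_enorm_pow_four_tsum_chr_le (summable_norm_col hc m)

theorem lintegral_tsum_slice {c : ℤ × ℤ → ℂ} (hc : Summable fun k => ‖c k‖) (s : ℝ) :
    ∫⁻ x in I2pi, ∑' m, wt s m * ‖slice c m x‖ₑ ^ 2 =
      ENNReal.ofReal (2 * π) * ∑' m, wt s m * ∑' k, ‖c (k, m)‖ₑ ^ 2 := by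
  rw [lintegral_tsum fun m =>
    ((continuous_slice hc m).enorm.measurable.pow_const 2).const_mul _ |>.aemeasurable,
    ← ENNReal.tsum_mul_left]
  refine tsum_congr fun m => ?_
  rw [lintegral_const_mul' _ _ (by simp [wt]), mul_left_comm]
  exact congrArg _ (lintegral_enorm_sq_tsum_chr (summable_norm_col hc m))

theorem ofReal_HSq {f : ℝ × ℝ → ℝ} (hf : Smooth f) (hp : Per f) (p q : ℝ) :
    ENNReal.ofReal (HSq p q f) = ∑' m, wt q m * ∑' k, wt p k * ‖fc f (k, m)‖ₑ ^ 2 := by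
  rw [HSq, ENNReal.ofReal_tsum_of_nonneg
    (fun k => mul_nonneg (aw_nonneg p q k) (sq_nonneg _)) (summable_aw_mul_norm_fc_sq hf hp p q),
    ENNReal.tsum_prod (f := fun k m => ENNReal.ofReal (aw p q (k, m) * ‖fc f (k, m)‖ ^ 2)),
    ENNReal.tsum_comm]
  refine tsum_congr fun m => ?_
  rw [← ENNReal.tsum_mul_left]
  refine tsum_congr fun k => ?_
  rw [aw, wt, wt, ENNReal.ofReal_mul (by positivity), ENNReal.ofReal_mul (by positivity),
    ENNReal.ofReal_pow (norm_nonneg _), ofReal_norm]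
  ring

theorem sq_tsum_le_wt (s : ℝ) (u : ℤ → ENNReal) :
    (∑' m, u m) ^ 2 ≤ (∑' m, wt (-s) m) * ∑' m, wt s m * u m ^ 2 := by
  have h := tsum_mul_sq_le (fun m => wt (-s / 2) m) (fun m => wt (s / 2) m * u m)
  have h1 : ∀ m, wt (-s / 2) m * (wt (s / 2) m * u m) = u m := fun m => by
    rw [← mul_assoc, wt_mul_wt, show -s / 2 + s / 2 = 0 by ring, wt_zero, one_mul]
  simp only [h1, mul_pow, wt_pow_two] at h
  rwa [show 2 * (-s / 2) = -s by ring, show 2 * (s / 2) = s by ring] at h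

theorem tsum_wt_neg_ne_top {s : ℝ} (hs : 1 / 2 < s) : ∑' m, wt (-s) m ≠ ⊤ := by
  simp only [wt]
  rw [← ENNReal.ofReal_tsum_of_nonneg (fun m => by positivity) (summable_rpow_neg_one_add_sq hs)]
  exact ENNReal.ofReal_ne_top

theorem IsDyadicPartition.exists_paraproduct_young {χ θ : ℝ → ℝ} (hp : IsDyadicPartition χ θ)
    {s : ℝ} (hs : 0 ≤ s) : ∃ D : ENNReal, D ≠ ⊤ ∧ ∀ α γ : ℤ → ℂ,
      ∑' n, wt s n * ‖∑' m, (paraSymb χ θ m (n - m) : ℂ) * α m * γ (n - m)‖ₑ ^ 2 ≤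
        D * (∑' m, ‖α m‖ₑ) ^ 2 * ∑' l, wt s l * ‖γ l‖ₑ ^ 2 := by
  obtain ⟨D, hD, h⟩ := hp.exists_paraSymb_bound
  refine ⟨ENNReal.ofReal (D ^ (s / 2)) ^ 2, by simp, fun α γ => ?_⟩
  have hwt : ∀ m l : ℤ, wt (s / 2) (m + l) * ‖(paraSymb χ θ m l : ℂ)‖ₑ ≤
      ENNReal.ofReal (D ^ (s / 2)) * wt (s / 2) l := by
    intro m l
    rcases eq_or_ne (paraSymb χ θ m l) 0 with h0 | h0
    · simp [h0]
    have h1 : ‖(paraSymb χ θ m l : ℂ)‖ₑ ≤ 1 := by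
      rw [← ofReal_norm, Complex.norm_of_nonneg (hp.paraSymb_nonneg _ _)]
      exact ENNReal.ofReal_le_one.2 (hp.paraSymb_le_one _ _)
    refine (mul_le_of_le_one_right' h1).trans ?_
    rw [wt, wt, ← ENNReal.ofReal_mul (by positivity), ← Real.mul_rpow (by positivity)
      (by positivity)]
    exact ENNReal.ofReal_le_ofReal
      (Real.rpow_le_rpow (by positivity) (h m l h0) (by positivity))
  have hterm : ∀ n, wt s n * ‖∑' m, (paraSymb χ θ m (n - m) : ℂ) * α m * γ (n - m)‖ₑ ^ 2 ≤
      ENNReal.ofReal (D ^ (s / 2)) ^ 2 *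
        (∑' m, ‖α m‖ₑ * (wt (s / 2) (n - m) * ‖γ (n - m)‖ₑ)) ^ 2 := by
    intro n
    rw [show wt s n = wt (s / 2) n ^ 2 by rw [wt_pow_two]; congr 1; ring, ← mul_pow, ← mul_pow]
    refine pow_le_pow_left' ?_ 2
    refine (mul_le_mul' le_rfl
      (enorm_tsum_le_tsum_enorm (f := fun m => (paraSymb χ θ m (n - m) : ℂ) * α m * γ (n - m)))).trans ?_
    rw [← ENNReal.tsum_mul_left, ← ENNReal.tsum_mul_left]
    refine ENNReal.tsum_le_tsum fun m => ?_
    have := hwt m (n - m)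
    rw [add_sub_cancel] at this
    rw [enorm_mul, enorm_mul]
    calc wt (s / 2) n * (‖(paraSymb χ θ m (n - m) : ℂ)‖ₑ * ‖α m‖ₑ * ‖γ (n - m)‖ₑ)
        = wt (s / 2) n * ‖(paraSymb χ θ m (n - m) : ℂ)‖ₑ * (‖α m‖ₑ * ‖γ (n - m)‖ₑ) := by ring
      _ ≤ ENNReal.ofReal (D ^ (s / 2)) * wt (s / 2) (n - m) * (‖α m‖ₑ * ‖γ (n - m)‖ₑ) := by
        gcongr
      _ = _ := by ring
  refine (ENNReal.tsum_le_tsum hterm).trans ?_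
  rw [ENNReal.tsum_mul_left, mul_assoc]
  gcongr
  refine (tsum_conv_sq_le (fun m => ‖α m‖ₑ) fun l => wt (s / 2) l * ‖γ l‖ₑ).trans_eq ?_
  simp only [mul_pow, wt_pow_two]
  rw [show 2 * (s / 2) = s by ring]

theorem ofReal_integral_le_lintegral_ofReal {X : Type*} [MeasurableSpace X] {μ : Measure X}
    {f : X → ℝ} (hf : ∀ x, 0 ≤ f x) :
    ENNReal.ofReal (∫ x, f x ∂μ) ≤ ∫⁻ x, ENNReal.ofReal (f x) ∂μ := by
  by_cases h : Integrable f μ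
  · exact (ofReal_integral_eq_lintegral_ofReal h (ae_of_all _ hf)).le
  · simp [integral_undef h]

/-- Hölder's inequality for the mixed norm, with an auxiliary horizontal weight. -/
theorem ofReal_L2vL43h_sq_le {F : ℝ × ℝ → ℂ} (hF : Continuous F) {W : ℝ → ENNReal}
    (hW : Measurable W) (hfin : ∫⁻ x in I2pi, W x ^ 2 ≠ ⊤)
    (hzero : ∀ x y, W x = 0 → F (x, y) = 0) :
    ENNReal.ofReal (L2vL43h F ^ 2) ≤ (∫⁻ x in I2pi, W x ^ 2) ^ (1 / 2 : ℝ) *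
      ∫⁻ x in I2pi, (W x)⁻¹ * ∫⁻ y in I2pi, ‖F (x, y)‖ₑ ^ 2 := by
  have hFm : Measurable fun z : ℝ × ℝ => ‖F z‖ₑ ^ 2 := hF.enorm.measurable.pow_const 2
  have hWtop : ∀ᵐ x ∂volume.restrict I2pi, W x ≠ ⊤ := by
    filter_upwards [ae_lt_top (hW.pow_const 2) hfin] with x hx h
    simp [h] at hx
  have hpt : ∀ y, (∫⁻ x in I2pi, ‖F (x, y)‖ₑ ^ (4 / 3 : ℝ)) ^ (3 / 2 : ℝ) ≤
      (∫⁻ x in I2pi, W x ^ 2) ^ (1 / 2 : ℝ) *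
        ∫⁻ x in I2pi, (W x)⁻¹ * ‖F (x, y)‖ₑ ^ 2 := by
    intro y
    have h1 : ∫⁻ x in I2pi, ‖F (x, y)‖ₑ ^ (4 / 3 : ℝ) ≤
        (∫⁻ x in I2pi, (W x)⁻¹ * ‖F (x, y)‖ₑ ^ 2) ^ (2 / 3 : ℝ) *
          (∫⁻ x in I2pi, W x ^ 2) ^ (1 / 3 : ℝ) := by
      refine (lintegral_mono_ae ?_).trans (ENNReal.lintegral_mul_norm_pow_le
        (hW.inv.mul (hFm.comp measurable_prodMk_right)).aemeasurable
        (hW.pow_const 2).aemeasurable (by norm_num) (by norm_num) (by norm_num))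
      filter_upwards [hWtop] with x hx
      rcases eq_or_ne (W x) 0 with h0 | h0
      · simp [hzero x y h0]
      refine le_of_eq ?_
      change _ = ((W x)⁻¹ * ‖F (x, y)‖ₑ ^ 2) ^ (2 / 3 : ℝ) * (W x ^ 2) ^ (1 / 3 : ℝ)
      rw [ENNReal.mul_rpow_of_nonneg _ _ (by norm_num), ← ENNReal.rpow_two, ← ENNReal.rpow_two,
        ← ENNReal.rpow_mul, ← ENNReal.rpow_mul, mul_right_comm, ENNReal.inv_rpow]
      norm_num
      rw [ENNReal.inv_mul_cancel (by simp [h0, hx]) (by simp [h0, hx]), one_mul]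
    refine (ENNReal.rpow_le_rpow h1 (by norm_num)).trans_eq ?_
    rw [ENNReal.mul_rpow_of_nonneg _ _ (by norm_num), ← ENNReal.rpow_mul, ← ENNReal.rpow_mul,
      mul_comm]
    norm_num
  rw [L2vL43h, Real.sq_sqrt (by positivity)]
  refine (ofReal_integral_le_lintegral_ofReal fun y => by positivity).trans ?_
  calc ∫⁻ y in I2pi, ENNReal.ofReal
        ((∫ x in I2pi, ‖F (x, y)‖ ^ (4 / 3 : ℝ)) ^ (3 / 2 : ℝ))
      ≤ ∫⁻ y in I2pi, (∫⁻ x in I2pi, W x ^ 2) ^ (1 / 2 : ℝ) *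
        ∫⁻ x in I2pi, (W x)⁻¹ * ‖F (x, y)‖ₑ ^ 2 := by
        refine lintegral_mono fun y => le_trans ?_ (hpt y)
        rw [← ENNReal.ofReal_rpow_of_nonneg (by positivity) (by norm_num)]
        refine ENNReal.rpow_le_rpow ?_ (by norm_num)
        refine (ofReal_integral_le_lintegral_ofReal fun x => by positivity).trans_eq ?_
        refine lintegral_congr fun x => ?_
        rw [← ENNReal.ofReal_rpow_of_nonneg (norm_nonneg _) (by norm_num), ofReal_norm]
    _ = _ := by
        rw [lintegral_const_mul' _ _ (ENNReal.rpow_ne_top_of_nonneg (by norm_num) hfin),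
          lintegral_lintegral_swap]
        · congr 1
          refine lintegral_congr fun x => ?_
          exact lintegral_const_mul _ (hFm.comp measurable_prodMk_left)
        · exact (((hW.inv.comp measurable_snd).mul (hFm.comp measurable_swap))).aemeasurable

theorem IsDyadicPartition.exists_lintegral_blocks_le {χ θ : ℝ → ℝ}
    (hp : IsDyadicPartition χ θ) {s₀ s : ℝ} (hs₀ : 1 / 2 < s₀) (hs : 0 ≤ s) :
    ∃ E : ENNReal, E ≠ ⊤ ∧ ∀ a g : ℝ × ℝ → ℝ, (Summable fun k => ‖fc a k‖) →
      (Summable fun k => ‖fc g k‖) → ∀ (K : Finset {j : ℤ // -1 ≤ j}) (x : ℝ),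
      ∑ k ∈ K, ENNReal.ofReal ((2 : ℝ) ^ (2 * (k.1 : ℝ) * s)) *
          ∫⁻ y in I2pi, ‖LPC χ θ k.1 (Tv χ θ a g) (x, y)‖ₑ ^ 2 ≤
        (∑' m, wt s₀ m * ‖slice (fc a) m x‖ₑ ^ 2) *
          (E * ∑' l, wt s l * ‖slice (fc g) l x‖ₑ ^ 2) := by
  obtain ⟨B, hB, hBK⟩ := hp.exists_sum_blockSymb_bound hs
  obtain ⟨D, hD, hDy⟩ := hp.exists_paraproduct_young hs
  refine ⟨ENNReal.ofReal (2 * π) * ENNReal.ofReal B * D * ∑' m, wt (-s₀) m,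
    ENNReal.mul_ne_top (ENNReal.mul_ne_top (by finiteness) hD) (tsum_wt_neg_ne_top hs₀),
    fun a g ha hg K x => ?_⟩
  set τ := fun n => slice (paraCoef χ θ (fc a) (fc g)) n x with hτ
  have hτs : Summable fun n => ‖τ n‖ := summable_norm_slice (hp.summable_norm_paraCoef ha hg) x
  have hblock : ∀ j : ℤ, ∫⁻ y in I2pi, ‖LPC χ θ j (Tv χ θ a g) (x, y)‖ₑ ^ 2 =
      ENNReal.ofReal (2 * π) * ∑' n : ℤ, ENNReal.ofReal (blockSymb χ θ j n ^ 2) * ‖τ n‖ₑ ^ 2 := by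
    intro j
    simp only [hp.LPC_Tv_eq_slice ha hg]
    rw [lintegral_enorm_sq_tsum_chr (summable_norm_mul_of_le_one
      (fun n : ℤ => hp.blockSymb_nonneg j n) (fun n => hp.blockSymb_le_one j n) hτs)]
    congr 1
    refine tsum_congr fun n => ?_
    rw [enorm_mul, mul_pow, ← ofReal_norm (blockSymb χ θ j n : ℂ),
      Complex.norm_of_nonneg (hp.blockSymb_nonneg _ _),
      ENNReal.ofReal_pow (hp.blockSymb_nonneg _ _)]
  have hτle : ∑' n, wt s n * ‖τ n‖ₑ ^ 2 ≤
      D * ((∑' m, wt (-s₀) m) * ∑' m, wt s₀ m * ‖slice (fc a) m x‖ₑ ^ 2) *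
        ∑' l, wt s l * ‖slice (fc g) l x‖ₑ ^ 2 := by
    simp only [hτ, hp.slice_paraCoef ha hg]
    refine (hDy (fun m => slice (fc a) m x) fun l => slice (fc g) l x).trans ?_
    gcongr
    exact sq_tsum_le_wt s₀ _
  calc ∑ k ∈ K, ENNReal.ofReal ((2 : ℝ) ^ (2 * (k.1 : ℝ) * s)) *
          ∫⁻ y in I2pi, ‖LPC χ θ k.1 (Tv χ θ a g) (x, y)‖ₑ ^ 2
      = ENNReal.ofReal (2 * π) * ∑' n : ℤ, (∑ k ∈ K, ENNReal.ofReal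
          ((2 : ℝ) ^ (2 * (k.1 : ℝ) * s) * blockSymb χ θ k.1 n ^ 2)) * ‖τ n‖ₑ ^ 2 := by
        simp only [Finset.sum_mul]
        rw [Summable.tsum_finsetSum fun _ _ => ENNReal.summable, Finset.mul_sum]
        refine Finset.sum_congr rfl fun k _ => ?_
        rw [hblock, mul_left_comm, ← ENNReal.tsum_mul_left]
        congr 1
        refine tsum_congr fun n => ?_
        rw [ENNReal.ofReal_mul (by positivity)]
        exact (mul_assoc _ _ _).symm
    _ ≤ ENNReal.ofReal (2 * π) * ∑' n : ℤ, (ENNReal.ofReal B * wt s n) * ‖τ n‖ₑ ^ 2 := by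
        gcongr with n
        rw [← ENNReal.ofReal_sum_of_nonneg fun k _ => by positivity, wt,
          ← ENNReal.ofReal_mul hB.le]
        exact ENNReal.ofReal_le_ofReal (hBK K n)
    _ = ENNReal.ofReal (2 * π) * (ENNReal.ofReal B * ∑' n : ℤ, wt s n * ‖τ n‖ₑ ^ 2) := by
        simp only [mul_assoc, ENNReal.tsum_mul_left]
    _ ≤ _ := by
        refine (mul_le_mul' le_rfl (mul_le_mul' le_rfl hτle)).trans_eq ?_
        ring

theorem IsDyadicPartition.LPC_Tv_eq_zero {χ θ : ℝ → ℝ} (hp : IsDyadicPartition χ θ)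
    {a g : ℝ × ℝ → ℝ} (ha : Summable fun k => ‖fc a k‖) (hg : Summable fun k => ‖fc g k‖)
    (j : ℤ) {s : ℝ} {x : ℝ} (hx : ∑' m, wt s m * ‖slice (fc a) m x‖ₑ ^ 2 = 0) (y : ℝ) :
    LPC χ θ j (Tv χ θ a g) (x, y) = 0 := by
  have h : ∀ m, slice (fc a) m x = 0 := fun m => by
    have h1 := ENNReal.tsum_eq_zero.1 hx m
    have h2 : wt s m ≠ 0 := by
      rw [wt, Ne, ENNReal.ofReal_eq_zero, not_le]; positivity
    simpa [h2] using h1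
  rw [hp.LPC_Tv_eq_slice ha hg]
  simp [hp.slice_paraCoef ha hg, h]

theorem IsDyadicPartition.exists_sum_blocks_le {χ θ : ℝ → ℝ}
    (hp : IsDyadicPartition χ θ) {s₀ s : ℝ} (hs₀ : 1 / 2 < s₀) (hs : 0 ≤ s) :
    ∃ E : ENNReal, E ≠ ⊤ ∧ ∀ a g : ℝ × ℝ → ℝ, Smooth a → Per a → Smooth g → Per g →
      ∀ K : Finset {j : ℤ // -1 ≤ j},
      ∑ k ∈ K, ENNReal.ofReal ((2 : ℝ) ^ (2 * (k.1 : ℝ) * s) *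
          L2vL43h (LPC χ θ k.1 (Tv χ θ a g)) ^ 2) ≤
        E * (ENNReal.ofReal (HSq (1 / 4) s₀ a) * ENNReal.ofReal (HSq 0 s g)) := by
  obtain ⟨E, hE, h⟩ := hp.exists_lintegral_blocks_le hs₀ hs
  refine ⟨(ENNReal.ofReal (2 * π) * 20) ^ (1 / 2 : ℝ) * (E * ENNReal.ofReal (2 * π)),
    ENNReal.mul_ne_top (ENNReal.rpow_ne_top_of_nonneg (by norm_num) (by finiteness))
      (by finiteness), fun a g ha hpa hg hpg K => ?_⟩
  have hsa := summable_norm_fc ha hpa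
  have hsg := summable_norm_fc hg hpg
  set W : ℝ → ENNReal := fun x => ∑' m, wt s₀ m * ‖slice (fc a) m x‖ₑ ^ 2 with hW
  have hWm : Measurable W := Measurable.tsum fun m =>
    ((continuous_slice hsa m).enorm.measurable.pow_const 2).const_mul _
  have hW2 : ∫⁻ x in I2pi, W x ^ 2 ≤
      ENNReal.ofReal (2 * π) * 20 * ENNReal.ofReal (HSq (1 / 4) s₀ a) ^ 2 := by
    rw [ofReal_HSq ha hpa]
    exact lintegral_tsum_slice_sq_le hsa s₀
  have hfin : ∫⁻ x in I2pi, W x ^ 2 ≠ ⊤ := ne_top_of_le_ne_top (by finiteness) hW2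
  have hV : ∫⁻ x in I2pi, ∑' l, wt s l * ‖slice (fc g) l x‖ₑ ^ 2 =
      ENNReal.ofReal (2 * π) * ENNReal.ofReal (HSq 0 s g) := by
    rw [ofReal_HSq hg hpg, lintegral_tsum_slice hsg]
    simp only [wt_zero, one_mul]
  have hFm : ∀ k : {j : ℤ // -1 ≤ j}, Measurable fun x =>
      ∫⁻ y in I2pi, ‖LPC χ θ k.1 (Tv χ θ a g) (x, y)‖ₑ ^ 2 := fun k =>
    ((hp.continuous_LPC_Tv hsa hsg k.1).enorm.measurable.pow_const 2).lintegral_prod_right'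
  calc ∑ k ∈ K, ENNReal.ofReal ((2 : ℝ) ^ (2 * (k.1 : ℝ) * s) *
          L2vL43h (LPC χ θ k.1 (Tv χ θ a g)) ^ 2)
      ≤ ∑ k ∈ K, ENNReal.ofReal ((2 : ℝ) ^ (2 * (k.1 : ℝ) * s)) *
          ((∫⁻ x in I2pi, W x ^ 2) ^ (1 / 2 : ℝ) * ∫⁻ x in I2pi, (W x)⁻¹ *
            ∫⁻ y in I2pi, ‖LPC χ θ k.1 (Tv χ θ a g) (x, y)‖ₑ ^ 2) := by
        refine Finset.sum_le_sum fun k _ => ?_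
        rw [ENNReal.ofReal_mul (by positivity)]
        gcongr
        exact ofReal_L2vL43h_sq_le (hp.continuous_LPC_Tv hsa hsg _) hWm hfin
          fun x y hx => hp.LPC_Tv_eq_zero hsa hsg _ hx y
    _ = (∫⁻ x in I2pi, W x ^ 2) ^ (1 / 2 : ℝ) * ∫⁻ x in I2pi, (W x)⁻¹ *
          ∑ k ∈ K, ENNReal.ofReal ((2 : ℝ) ^ (2 * (k.1 : ℝ) * s)) *
            ∫⁻ y in I2pi, ‖LPC χ θ k.1 (Tv χ θ a g) (x, y)‖ₑ ^ 2 := by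
        simp only [Finset.mul_sum (s := K)]
        have hm : ∀ k ∈ K, Measurable fun x =>
            (W x)⁻¹ * (ENNReal.ofReal ((2 : ℝ) ^ (2 * (k.1 : ℝ) * s)) *
              ∫⁻ y in I2pi, ‖LPC χ θ k.1 (Tv χ θ a g) (x, y)‖ₑ ^ 2) := fun k _ =>
          hWm.inv.mul ((hFm k).const_mul _)
        rw [lintegral_finsetSum K hm, Finset.mul_sum]
        refine Finset.sum_congr rfl fun k _ => ?_
        rw [mul_left_comm, ← lintegral_const_mul' _ _ ENNReal.ofReal_ne_top]
        simp only [mul_left_comm]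
    _ ≤ (∫⁻ x in I2pi, W x ^ 2) ^ (1 / 2 : ℝ) *
          ∫⁻ x in I2pi, E * ∑' l, wt s l * ‖slice (fc g) l x‖ₑ ^ 2 := by
        refine mul_le_mul' le_rfl (lintegral_mono fun x => ?_)
        refine (mul_le_mul' le_rfl (h a g hsa hsg K x)).trans ?_
        rw [← mul_assoc, mul_comm (W x)⁻¹]
        exact mul_le_of_le_one_left' (ENNReal.mul_inv_le_one _)
    _ ≤ (ENNReal.ofReal (2 * π) * 20 * ENNReal.ofReal (HSq (1 / 4) s₀ a) ^ 2) ^ (1 / 2 : ℝ) *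
          (E * (ENNReal.ofReal (2 * π) * ENNReal.ofReal (HSq 0 s g))) := by
        rw [lintegral_const_mul' _ _ hE, hV]
        gcongr
    _ = _ := by
        rw [ENNReal.mul_rpow_of_nonneg _ _ (by norm_num), ← ENNReal.rpow_two,
          ← ENNReal.rpow_mul (ENNReal.ofReal (HSq (1 / 4) s₀ a))]
        norm_num
        ring

theorem HSq_nonneg (p q : ℝ) (f : ℝ × ℝ → ℝ) : 0 ≤ HSq p q f :=
  tsum_nonneg fun k => mul_nonneg (aw_nonneg p q k) (sq_nonneg _)

/-- paraproduct estimate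
`(Σ_{k≥−1} 2^{2ks} ‖Δ^v_k(T^v_a g)‖²_{L²_v(L^{4/3}_h)})^{1/2} ≤ C ‖a‖_{H^{1/4,s₀}} ‖g‖_{H^{0,s}}`. -/
theorem paraproduct_Tv_estimate (χ θ : ℝ → ℝ) (hp : IsDyadicPartition χ θ)
    (s₀ s : ℝ) (hs₀ : 1/2 < s₀) (hs : s₀ ≤ s) :
    ∃ C > 0, ∀ a g : ℝ × ℝ → ℝ, Smooth a → Per a → Smooth g → Per g →
      Real.sqrt (∑' k : {j : ℤ // -1 ≤ j},
          (2 : ℝ) ^ (2 * (k.1 : ℝ) * s) * L2vL43h (LPC χ θ k.1 (Tv χ θ a g)) ^ 2) ≤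
        C * HN (1/4) s₀ a * HN 0 s g := by
  obtain ⟨E, hE, h⟩ := hp.exists_sum_blocks_le hs₀ (by linarith : 0 ≤ s)
  refine ⟨Real.sqrt (E.toReal + 1), by positivity, fun a g ha hpa hg hpg => ?_⟩
  rw [HN, HN, ← Real.sqrt_mul (by positivity), ← Real.sqrt_mul
    (mul_nonneg (by positivity) (HSq_nonneg _ _ _)), mul_assoc]
  refine Real.sqrt_le_sqrt ?_
  have hH := mul_nonneg (HSq_nonneg (1 / 4) s₀ a) (HSq_nonneg 0 s g)
  refine Real.tsum_le_of_sum_le (fun k => by positivity) fun K => ?_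
  have hK := h a g ha hpa hg hpg K
  rw [← ENNReal.ofReal_sum_of_nonneg fun k _ => by positivity,
    ← ENNReal.ofReal_mul (HSq_nonneg _ _ _), ← ENNReal.ofReal_toReal hE,
    ← ENNReal.ofReal_mul ENNReal.toReal_nonneg,
    ENNReal.ofReal_le_ofReal_iff (mul_nonneg ENNReal.toReal_nonneg hH)] at hK
  nlinarith

end Aniso
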